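/- arXiv:1611.01996 — 5 statements merged into one kernel-verified Lean document; each statement's English description precedes it below -/
import Mathlib

section
/- (Main Łojasiewicz estimate, real moment map, torus case.) For every f_c ≥ 0 there exist constants k > 0 and ε > 0 such that for all x ∈ ℂᴺ with |f(x) − f_c| < ε one has ‖∇f(x)‖ ≥ k·|f(x) − f_c|^{3/4}. In particular f = ‖μ‖² satisfies a global Łojasiewicz inequality with exponent 3/4 even though μ need not be proper. -/
open scoped InnerProductSpace

/-- Vectors in the span of finitely many vectors are controlled by their pairings with these. -/
lemma span_bound {E : Type*} [NormedAddCommGroup E] [InnerProductSpace ℝ E]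
    [FiniteDimensional ℝ E] {N : ℕ} (β : Fin N → E) (J : Finset (Fin N)) :
    ∃ K : ℝ, 0 ≤ K ∧ ∀ v ∈ Submodule.span ℝ (β '' (J : Set (Fin N))), ∀ δ : ℝ, 0 ≤ δ →
      (∀ j ∈ J, |⟪v, β j⟫_ℝ| ≤ δ) → ‖v‖ ≤ K * δ := by
  set V := Submodule.span ℝ (β '' (J : Set (Fin N))) with hV
  let T : V →ₗ[ℝ] (J → ℝ) :=
    LinearMap.pi fun j => (innerSL ℝ (β j)).toLinearMap ∘ₗ V.subtype
  have hT : LinearMap.ker T = ⊥ := by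
    rw [LinearMap.ker_eq_bot']
    intro v hv
    have h1 : ∀ j ∈ J, ⟪β j, (v : E)⟫_ℝ = 0 := fun j hj => congrFun hv ⟨j, hj⟩
    have h2 : (v : E) ∈ Vᗮ := by
      rw [Submodule.mem_orthogonal]
      intro u hu
      induction hu using Submodule.span_induction with
      | mem x hx => obtain ⟨j, hj, rfl⟩ := hx; exact h1 j (by simpa using hj)
      | zero => simp
      | add x y _ _ hx hy => rw [inner_add_left, hx, hy, add_zero]
      | smul a x _ hx => rw [inner_smul_left, hx, mul_zero]
    have h3 := Submodule.inner_right_of_mem_orthogonal v.2 h2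
    exact Subtype.ext (inner_self_eq_zero.mp h3)
  obtain ⟨K, -, hK⟩ := T.exists_antilipschitzWith hT
  refine ⟨K, K.2, fun v hv δ hδ h => ?_⟩
  have h4 : ‖v‖ ≤ K * ‖T ⟨v, hv⟩‖ := by
    have h5 := hK.le_mul_dist (⟨v, hv⟩ : V) 0
    rw [map_zero, dist_zero_right, dist_zero_right] at h5
    exact h5
  refine h4.trans (mul_le_mul_of_nonneg_left ?_ K.2)
  rw [pi_norm_le_iff_of_nonneg hδ]
  intro j
  rw [Real.norm_eq_abs]
  have := h j j.2
  rw [real_inner_comm] at this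
  exact this

/-- The key estimate: approximation of `‖m‖²` by one of finitely many critical values. -/
lemma key_estimate {E : Type*} [NormedAddCommGroup E] [InnerProductSpace ℝ E]
    [FiniteDimensional ℝ E] {N : ℕ} (β : Fin N → E) (α : E) :
    ∃ c : Finset (Fin N) → ℝ, ∃ C : ℝ, 1 ≤ C ∧ ∀ t : Fin N → ℝ, (∀ j, 0 ≤ t j) → ∀ δ : ℝ, 0 < δ →
      ∀ m : E, m = (1 / 2 : ℝ) • ∑ j, t j • β j - α →
      4 * ∑ j, t j * ⟪m, β j⟫_ℝ ^ 2 ≤ δ ^ 3 → ∃ J, |‖m‖ ^ 2 - c J| ≤ C * δ ^ 2 := by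
  classical
  choose K hK0 hK using span_bound β
  let V : Finset (Fin N) → Submodule ℝ E := fun J => Submodule.span ℝ (β '' (J : Set (Fin N)))
  let M := ∑ J, K J
  have hM0 : 0 ≤ M := Finset.sum_nonneg fun J _ => hK0 J
  have hKM : ∀ J, K J ≤ M := fun J =>
    Finset.single_le_sum (f := K) (fun J _ => hK0 J) (Finset.mem_univ J)
  let B := ∑ j, ‖β j‖
  have hB0 : 0 ≤ B := Finset.sum_nonneg fun J _ => norm_nonneg _
  have hB : ∀ j, ‖β j‖ ≤ B := fun j =>
    Finset.single_le_sum (f := fun j => ‖β j‖) (fun J _ => norm_nonneg _) (Finset.mem_univ j)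
  refine ⟨fun J => ‖(V J)ᗮ.starProjection α‖ ^ 2, 1 + M ^ 2 + M * B + B ^ 2, ?_, ?_⟩
  · have := mul_nonneg hM0 hB0
    nlinarith [sq_nonneg M, sq_nonneg B]
  intro t ht δ hδ m hm hG
  let J : Finset (Fin N) := Finset.univ.filter fun j => |⟪m, β j⟫_ℝ| ≤ δ
  refine ⟨J, ?_⟩
  set P := (V J)ᗮ.starProjection with hP
  set q := (V J).starProjection m with hq
  have hqV : q ∈ V J := Submodule.starProjection_apply_mem _ _
  have hsum : q + P m = m := by
    simp [hq, hP, Submodule.starProjection_orthogonal_val]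
  have hPV : P m ∈ (V J)ᗮ := Submodule.starProjection_apply_mem _ _
  have hPβ : ∀ j ∈ J, P (β j) = 0 := by
    intro j hj
    have : β j ∈ V J := Submodule.subset_span ⟨j, by simpa using hj, rfl⟩
    simp [hP, Submodule.starProjection_orthogonal_val,
      Submodule.starProjection_eq_self_iff.mpr this]
  have hβV : ∀ j ∈ J, β j ∈ V J := fun j hj => Submodule.subset_span ⟨j, by simpa using hj, rfl⟩
  have hqn : ‖q‖ ≤ M * δ := by
    refine (hK J q hqV δ hδ.le ?_).trans (mul_le_mul_of_nonneg_right (hKM J) hδ.le)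
    intro j hj
    have h0 : ⟪P m, β j⟫_ℝ = 0 := Submodule.inner_left_of_mem_orthogonal (hβV j hj) hPV
    have : ⟪m, β j⟫_ℝ = ⟪q, β j⟫_ℝ := by
      rw [← hsum, inner_add_left, h0, add_zero]
    rw [← this]
    simpa [J] using hj
  have hsplit : ‖m‖ ^ 2 = ‖q‖ ^ 2 + ‖P m‖ ^ 2 := by
    have h0 : ⟪q, P m⟫_ℝ = 0 := Submodule.inner_right_of_mem_orthogonal hqV hPV
    have h1 : ‖m‖ ^ 2 = ‖q + P m‖ ^ 2 := by rw [hsum]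
    rw [h1, norm_add_sq_real, h0]; ring
  have hJc : ∀ j ∈ Jᶜ, δ < |⟪m, β j⟫_ℝ| := by
    intro j hj
    simpa [J] using hj
  -- sums over the complement
  have hG2 : ∑ j ∈ Jᶜ, t j * ⟪m, β j⟫_ℝ ^ 2 ≤ δ ^ 3 / 4 := by
    have : ∑ j ∈ Jᶜ, t j * ⟪m, β j⟫_ℝ ^ 2 ≤ ∑ j, t j * ⟪m, β j⟫_ℝ ^ 2 :=
      Finset.sum_le_sum_of_subset_of_nonneg (Finset.subset_univ _)
        fun j _ _ => mul_nonneg (ht j) (sq_nonneg _)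
    linarith
  have hA : ∑ j ∈ Jᶜ, t j * |⟪m, β j⟫_ℝ| ≤ δ ^ 2 / 4 := by
    have : δ * ∑ j ∈ Jᶜ, t j * |⟪m, β j⟫_ℝ| ≤ ∑ j ∈ Jᶜ, t j * ⟪m, β j⟫_ℝ ^ 2 := by
      rw [Finset.mul_sum]
      refine Finset.sum_le_sum fun j hj => ?_
      rw [← sq_abs ⟪m, β j⟫_ℝ]
      have := mul_le_mul_of_nonneg_left (hJc j hj).le (mul_nonneg (ht j) (abs_nonneg ⟪m, β j⟫_ℝ))
      linarith
    have h2 : δ * ∑ j ∈ Jᶜ, t j * |⟪m, β j⟫_ℝ| ≤ δ * (δ ^ 2 / 4) := by linarith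
    exact le_of_mul_le_mul_left h2 hδ
  have hS : ∑ j ∈ Jᶜ, t j ≤ δ / 4 := by
    have : δ * ∑ j ∈ Jᶜ, t j ≤ ∑ j ∈ Jᶜ, t j * |⟪m, β j⟫_ℝ| := by
      rw [Finset.mul_sum]
      refine Finset.sum_le_sum fun j hj => ?_
      have := mul_le_mul_of_nonneg_left (hJc j hj).le (ht j)
      linarith
    have h2 : δ * ∑ j ∈ Jᶜ, t j ≤ δ * (δ / 4) := by linarith
    exact le_of_mul_le_mul_left h2 hδ
  set w := (1 / 2 : ℝ) • ∑ j ∈ Jᶜ, t j • P (β j) with hw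
  have hPm : P m = w - P α := by
    have h1 : ∑ j ∈ J, t j • P (β j) = 0 :=
      Finset.sum_eq_zero fun j hj => by rw [hPβ j hj, smul_zero]
    have h2 := Finset.sum_add_sum_compl J fun j => t j • P (β j)
    rw [h1, zero_add] at h2
    rw [hw, h2]
    conv_lhs => rw [hm]
    simp [map_sub, map_smul, map_sum]
  have hPn : ∀ v, ‖P v‖ ≤ ‖v‖ := fun v => Submodule.norm_starProjection_apply_le _ v
  have hwn : ‖w‖ ≤ B * δ := by
    have h1 : ‖∑ j ∈ Jᶜ, t j • P (β j)‖ ≤ (∑ j ∈ Jᶜ, t j) * B := by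
      rw [Finset.sum_mul]
      refine norm_sum_le_of_le _ fun j _ => ?_
      rw [norm_smul, Real.norm_of_nonneg (ht j)]
      exact mul_le_mul_of_nonneg_left ((hPn _).trans (hB j)) (ht j)
    rw [hw, norm_smul]
    have h2 := mul_le_mul_of_nonneg_right hS hB0
    have h3 := mul_nonneg hB0 hδ.le
    norm_num
    nlinarith
  have hin : ∀ j, ⟪P m, P (β j)⟫_ℝ = ⟪m, β j⟫_ℝ - ⟪q, β j⟫_ℝ := by
    intro j
    have h1 : ⟪P m, P (β j)⟫_ℝ = ⟪P m, β j⟫_ℝ := by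
      rw [hP, ← Submodule.inner_starProjection_left_eq_right,
        Submodule.starProjection_eq_self_iff.mpr hPV]
    rw [h1, ← inner_sub_left]
    congr 1
    exact eq_sub_of_add_eq' hsum
  have hpw : |2 * ⟪P m, w⟫_ℝ| ≤ δ ^ 2 / 4 + (δ / 4) * (M * δ * B) := by
    have h1 : 2 * ⟪P m, w⟫_ℝ = ∑ j ∈ Jᶜ, t j * (⟪m, β j⟫_ℝ - ⟪q, β j⟫_ℝ) := by
      rw [hw, inner_smul_right, inner_sum]
      simp only [inner_smul_right, hin]
      ring
    rw [h1]
    have h2 : ∀ j ∈ Jᶜ, |t j * (⟪m, β j⟫_ℝ - ⟪q, β j⟫_ℝ)| ≤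
        t j * |⟪m, β j⟫_ℝ| + t j * (M * δ * B) := by
      intro j _
      rw [abs_mul, abs_of_nonneg (ht j), ← mul_add]
      refine mul_le_mul_of_nonneg_left ((abs_sub _ _).trans (add_le_add_right ?_ _)) (ht j)
      exact (abs_real_inner_le_norm _ _).trans
        (mul_le_mul hqn (hB j) (norm_nonneg _) (mul_nonneg hM0 hδ.le))
    refine (Finset.abs_sum_le_sum_abs _ _).trans ((Finset.sum_le_sum h2).trans ?_)
    rw [Finset.sum_add_distrib, ← Finset.sum_mul]
    exact add_le_add hA (mul_le_mul_of_nonneg_right hS (by positivity))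
  have hfin : ‖m‖ ^ 2 - ‖P α‖ ^ 2 = ‖q‖ ^ 2 + 2 * ⟪P m, w⟫_ℝ - ‖w‖ ^ 2 := by
    have h1 : P α = w - P m := by rw [hPm]; abel
    have h2 : ‖P α‖ ^ 2 = ‖w‖ ^ 2 - 2 * ⟪w, P m⟫_ℝ + ‖P m‖ ^ 2 := by
      rw [h1, norm_sub_sq_real]
    rw [hsplit, h2, real_inner_comm]; ring
  show |‖m‖ ^ 2 - ‖P α‖ ^ 2| ≤ _
  rw [hfin]
  have hq2 : ‖q‖ ^ 2 ≤ (M * δ) ^ 2 := pow_le_pow_left₀ (norm_nonneg _) hqn 2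
  have hw2 : ‖w‖ ^ 2 ≤ (B * δ) ^ 2 := pow_le_pow_left₀ (norm_nonneg _) hwn 2
  have hMB : 0 ≤ M * B * δ ^ 2 := by positivity
  rw [abs_le] at hpw ⊢
  constructor <;> nlinarith [sq_nonneg ‖q‖, sq_nonneg ‖w‖, sq_nonneg δ, sq_nonneg (M * δ), sq_nonneg (B * δ)]

/-- The gradient of `‖μ‖²`. -/
lemma grad_formula {N : ℕ} {E : Type*} [NormedAddCommGroup E] [InnerProductSpace ℝ E]
    (β : Fin N → E) (α : E) (x : EuclideanSpace ℂ (Fin N)) :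
    HasGradientAt (fun y : EuclideanSpace ℂ (Fin N) =>
        ‖(1 / 2 : ℝ) • ∑ j, (‖y j‖ ^ 2) • β j - α‖ ^ 2)
      (WithLp.toLp 2 fun j =>
        (2 * ⟪(1 / 2 : ℝ) • ∑ j, (‖x j‖ ^ 2) • β j - α, β j⟫_ℝ) • x j) x := by
  rw [hasGradientAt_iff_hasFDerivAt]
  have h1 : ∀ j, HasFDerivAt (fun y : EuclideanSpace ℂ (Fin N) => ‖y j‖ ^ 2)
      (2 • (innerSL ℝ (x j)).comp (EuclideanSpace.proj (𝕜 := ℂ) j |>.restrictScalars ℝ)) x := by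
    intro j
    exact ((EuclideanSpace.proj (𝕜 := ℂ) j |>.restrictScalars ℝ).hasFDerivAt (x := x)).norm_sq
  have h2 := ((HasFDerivAt.fun_sum (u := Finset.univ) fun j _ =>
    (h1 j).smul_const (β j)).const_smul (1 / 2 : ℝ)).sub_const α |>.norm_sq
  refine h2.congr_fderiv ?_
  ext v
  simp only [Pi.smul_apply]
  generalize (1 / 2 : ℝ) • ∑ j, (‖x j‖ ^ 2) • β j - α = m
  simp [PiLp.inner_apply, inner_sum, inner_smul_right, Finset.mul_sum]
  refine Finset.sum_congr rfl fun j _ => ?_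
  ring


/-- **Global Łojasiewicz estimate for the norm-square of the moment map of a
linear torus action on `ℂᴺ`.**  With `μ x = (1/2) ∑ⱼ |xⱼ|² βⱼ - α` and `f = ‖μ‖²`,
for every `f_c ≥ 0` there are `k > 0` and `ε > 0` such that
`‖∇f x‖ ≥ k * |f x - f_c| ^ (3/4)` whenever `|f x - f_c| < ε`. -/
theorem stmt_1
    (N r : ℕ) (hN : 1 ≤ N) (hr : 1 ≤ r)
    (β : Fin N → EuclideanSpace ℝ (Fin r)) (α : EuclideanSpace ℝ (Fin r))
    (μ : EuclideanSpace ℂ (Fin N) → EuclideanSpace ℝ (Fin r))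
    (hμ : ∀ x : EuclideanSpace ℂ (Fin N), ∀ a : Fin r,
      μ x a = (1 / 2 : ℝ) * (∑ j, ‖x j‖ ^ 2 * β j a) - α a)
    (f : EuclideanSpace ℂ (Fin N) → ℝ)
    (hf : ∀ x, f x = ‖μ x‖ ^ 2)
    (fc : ℝ) (hfc : 0 ≤ fc) :
    ∃ k > (0 : ℝ), ∃ ε > (0 : ℝ), ∀ x : EuclideanSpace ℂ (Fin N),
      |f x - fc| < ε → k * |f x - fc| ^ (3 / 4 : ℝ) ≤ ‖gradient f x‖ := by
  obtain ⟨c, C, hC, hkey⟩ := key_estimate β α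
  have hμ' : ∀ x, μ x = (1 / 2 : ℝ) • ∑ j, (‖x j‖ ^ 2) • β j - α := by
    intro x
    ext a
    simp [hμ]
  have hf' : f = fun y : EuclideanSpace ℂ (Fin N) =>
      ‖(1 / 2 : ℝ) • ∑ j, (‖y j‖ ^ 2) • β j - α‖ ^ 2 := by
    funext y; rw [hf, hμ']
  have hgrad : ∀ x, ‖gradient f x‖ ^ 2 = 4 * ∑ j, ‖x j‖ ^ 2 * ⟪μ x, β j⟫_ℝ ^ 2 := by
    intro x
    have := (grad_formula β α x).gradient
    rw [← hf', ← hμ' x] at this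
    rw [this, EuclideanSpace.norm_sq_eq, Finset.mul_sum]
    refine Finset.sum_congr rfl fun j _ => ?_
    simp only [norm_smul, Real.norm_eq_abs, mul_pow, sq_abs]
    ring
  -- the gap between `fc` and the other critical values
  obtain ⟨ε, hε, hgap⟩ : ∃ ε > (0 : ℝ), ∀ J, |c J - fc| < ε → c J = fc := by
    have h : ∀ J, ∀ᶠ ε in nhdsWithin (0 : ℝ) (Set.Ioi 0), |c J - fc| < ε → c J = fc := by
      intro J
      by_cases h : c J = fc
      · exact Filter.Eventually.of_forall fun _ _ => h
      · have : 0 < |c J - fc| := abs_pos.mpr (sub_ne_zero.mpr h)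
        filter_upwards [Ioo_mem_nhdsGT this] with ε hε h2
        exact absurd h2 (not_lt.mpr hε.2.le)
    obtain ⟨ε, h1, h2⟩ := ((Filter.eventually_all.mpr h).and self_mem_nhdsWithin).exists
    exact ⟨ε, h2, h1⟩
  set s : ℝ := 1 / (2 * C) with hs
  have hs0 : 0 < s := by positivity
  have hsC : C * s ^ 2 ≤ 1 / 2 := by
    have h1 : C * s = 1 / 2 := by rw [hs]; field_simp
    have h2 : s ≤ 1 := by nlinarith
    nlinarith
  refine ⟨s ^ (3 / 2 : ℝ), by positivity, ε / 2, by positivity, fun x hx => ?_⟩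
  by_contra! hlt
  set d := |f x - fc| with hd
  have hd0 : 0 < d := by
    rcases (abs_nonneg (f x - fc)).eq_or_lt with h | h
    · exfalso
      have h0 : d = 0 := h.symm
      rw [h0, Real.zero_rpow (by norm_num), mul_zero] at hlt
      exact absurd hlt (not_lt.mpr (norm_nonneg _))
    · exact h
  set δ := s * Real.sqrt d with hδ
  have hδ0 : 0 < δ := by positivity
  have hδ3 : (s ^ (3 / 2 : ℝ) * d ^ (3 / 4 : ℝ)) ^ 2 = δ ^ 3 := by
    rw [hδ, Real.sqrt_eq_rpow, mul_pow, mul_pow, ← Real.rpow_natCast, ← Real.rpow_natCast,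
      ← Real.rpow_natCast, ← Real.rpow_natCast, ← Real.rpow_mul hs0.le, ← Real.rpow_mul hd0.le,
      ← Real.rpow_mul hd0.le]
    norm_num
  have hδ2 : δ ^ 2 = s ^ 2 * d := by
    rw [hδ, mul_pow, Real.sq_sqrt hd0.le]
  have hle : 4 * ∑ j, ‖x j‖ ^ 2 * ⟪μ x, β j⟫_ℝ ^ 2 ≤ δ ^ 3 := by
    rw [← hgrad, ← hδ3]
    exact pow_le_pow_left₀ (norm_nonneg _) hlt.le 2
  obtain ⟨J, hJ⟩ := hkey (fun j => ‖x j‖ ^ 2) (fun j => sq_nonneg _) δ hδ0 (μ x) (hμ' x) hle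
  rw [← hf, hδ2] at hJ
  have hJ2 : |f x - c J| ≤ d / 2 := by nlinarith
  have hc : c J = fc := by
    apply hgap
    have h1 : |c J - fc| ≤ |c J - f x| + |f x - fc| := abs_sub_le _ _ _
    rw [abs_sub_comm (c J) (f x)] at h1
    linarith
  rw [hc] at hJ2
  linarith
end

section
/- (Main Łojasiewicz estimate for the complex moment map of a torus.) Let f = ‖μ_c‖² on ℂᴺ × ℂᴺ. For every f_c ≥ 0 there exist constants k > 0 and ε > 0 such that for all (x,y) ∈ ℂᴺ × ℂᴺ with |f(x,y) − f_c| < ε one has ‖∇f(x,y)‖ ≥ k·|f(x,y) − f_c|^{3/4}. -/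
section aux

variable {E : Type*} [NormedAddCommGroup E] [InnerProductSpace ℂ E] [FiniteDimensional ℂ E]
variable {ι : Type*} [Fintype ι]

lemma aux_proj (b : ι → E) (J : Finset ι) :
    ∃ C : ℝ, 0 ≤ C ∧ ∀ (u : E) (t : ℝ), 0 ≤ t → (∀ j ∈ J, ‖inner ℂ (b j) u‖ ≤ t) →
      ‖(Submodule.span ℂ (b '' (J : Set ι))).starProjection u‖ ≤ C * t := by
  set K := Submodule.span ℂ (b '' (J : Set ι)) with hK
  let T : K →ₗ[ℂ] (J → ℂ) :=
    LinearMap.pi fun j => ((innerSL ℂ (b j)).toLinearMap).comp K.subtype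
  have hT : ∀ (v : K) (j : J), T v j = inner ℂ (b j) (v : E) := fun v j => rfl
  have hker : LinearMap.ker T = ⊥ := by
    rw [LinearMap.ker_eq_bot']
    intro v hv
    have h1 : ∀ w ∈ K, inner ℂ w (v : E) = 0 := by
      intro w hw
      refine Submodule.span_induction (p := fun w _ => inner ℂ w (v : E) = 0) ?_ ?_ ?_ ?_ hw
      · rintro _ ⟨j, hj, rfl⟩
        have := congrFun hv ⟨j, hj⟩
        simpa [hT] using this
      · simp
      · intro x y _ _ hx hy
        rw [inner_add_left, hx, hy, add_zero]
      · intro a x _ hx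
        rw [inner_smul_left, hx, mul_zero]
    have h2 := h1 v v.2
    rw [inner_self_eq_zero] at h2
    exact Subtype.ext h2
  obtain ⟨C, _, hC⟩ := LinearMap.exists_antilipschitzWith T hker
  refine ⟨C, C.2, fun u t ht h => ?_⟩
  have h1 := hC.le_mul_dist (⟨K.starProjection u, K.starProjection_apply_mem u⟩ : K) 0
  rw [map_zero, dist_zero_right, dist_zero_right] at h1
  refine h1.trans (mul_le_mul_of_nonneg_left ?_ C.2)
  rw [pi_norm_le_iff_of_nonneg ht]
  rintro ⟨j, hj⟩
  rw [hT]
  have hb : K.starProjection (b j) = b j :=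
    Submodule.starProjection_eq_self_iff.2 (Submodule.subset_span ⟨j, hj, rfl⟩)
  change ‖inner ℂ (b j) (K.starProjection u)‖ ≤ t
  rw [← Submodule.inner_starProjection_left_eq_right, hb]
  exact h j hj

lemma aux_J (b : ι → E) (α : E) (J : Finset ι) :
    ∃ C : ℝ, 0 ≤ C ∧ ∀ (w : ι → ℂ) (t : ℝ), 0 ≤ t →
      (∀ j ∈ J, ‖inner ℂ (b j) (∑ i, w i • b i - α)‖ ≤ t) →
      (∀ j ∉ J, ‖w j‖ ≤ t ∧ ‖w j‖ * ‖inner ℂ (b j) (∑ i, w i • b i - α)‖ ≤ t ^ 2) →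
      |‖∑ i, w i • b i - α‖ ^ 2 -
        ‖(Submodule.span ℂ (b '' (J : Set ι)))ᗮ.starProjection α‖ ^ 2| ≤ C * t ^ 2 := by
  classical
  obtain ⟨C, hC0, hC⟩ := aux_proj b J
  set K := Submodule.span ℂ (b '' (J : Set ι)) with hK
  set S := ∑ j ∈ Jᶜ, ‖b j‖ with hS
  refine ⟨C ^ 2 + 2 * ∑ j ∈ Jᶜ, (1 + ‖b j‖ * C) + S ^ 2, ?_, ?_⟩
  · have : 0 ≤ ∑ j ∈ Jᶜ, (1 + ‖b j‖ * C) := Finset.sum_nonneg fun j _ => by positivity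
    positivity
  intro w t ht h1 h2
  set μ := ∑ i, w i • b i - α with hμ
  have hP := hC μ t ht h1
  set s := ∑ j ∈ Jᶜ, w j • b j with hs
  have hQb : ∀ j ∈ J, Kᗮ.starProjection (b j) = 0 := by
    intro j hj
    exact Submodule.starProjection_orthogonal_apply_eq_zero (Submodule.subset_span ⟨j, hj, rfl⟩)
  have hQ : Kᗮ.starProjection α = Kᗮ.starProjection s - Kᗮ.starProjection μ := by
    rw [hμ, map_sub, ← Finset.sum_add_sum_compl J, map_add, ← hs]
    have : Kᗮ.starProjection (∑ j ∈ J, w j • b j) = 0 := by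
      rw [map_sum]
      refine Finset.sum_eq_zero fun j hj => ?_
      rw [map_smul, hQb j hj, smul_zero]
    rw [this]; abel
  have hsn : ‖Kᗮ.starProjection s‖ ≤ S * t := by
    refine (Submodule.norm_starProjection_apply_le _ _).trans ?_
    rw [hs, hS, Finset.sum_mul]
    refine (norm_sum_le _ _).trans (Finset.sum_le_sum fun j hj => ?_)
    rw [norm_smul, mul_comm]
    exact mul_le_mul_of_nonneg_left (h2 j (by simpa using hj)).1 (norm_nonneg _)
  have hin : ‖inner ℂ (Kᗮ.starProjection s) (Kᗮ.starProjection μ)‖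
      ≤ (∑ j ∈ Jᶜ, (1 + ‖b j‖ * C)) * t ^ 2 := by
    have hidem : Kᗮ.starProjection (Kᗮ.starProjection μ) = Kᗮ.starProjection μ :=
      Submodule.starProjection_eq_self_iff.2 (Submodule.starProjection_apply_mem _ _)
    rw [Submodule.inner_starProjection_left_eq_right, hidem, hs, sum_inner, Finset.sum_mul]
    refine (norm_sum_le _ _).trans (Finset.sum_le_sum fun j hj => ?_)
    obtain ⟨h3, h4⟩ := h2 j (by simpa using hj)
    have h5 : Kᗮ.starProjection μ = μ - K.starProjection μ := by
      rw [eq_sub_iff_add_eq, add_comm]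
      exact Submodule.starProjection_add_starProjection_orthogonal μ
    rw [inner_smul_left, norm_mul, RCLike.norm_conj, h5, inner_sub_right]
    have h6 : ‖inner ℂ (b j) (K.starProjection μ)‖ ≤ ‖b j‖ * (C * t) :=
      (norm_inner_le_norm _ _).trans (mul_le_mul_of_nonneg_left hP (norm_nonneg _))
    calc _ ≤ ‖w j‖ * (‖inner ℂ (b j) μ‖ + ‖b j‖ * (C * t)) :=
          mul_le_mul_of_nonneg_left ((norm_sub_le _ _).trans (by gcongr)) (norm_nonneg _)
      _ = ‖w j‖ * ‖inner ℂ (b j) μ‖ + ‖w j‖ * (‖b j‖ * (C * t)) := by ring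
      _ ≤ t ^ 2 + t * (‖b j‖ * (C * t)) := by gcongr
      _ = _ := by ring
  have hre := (Complex.abs_re_le_norm (inner ℂ (Kᗮ.starProjection s) (Kᗮ.starProjection μ))).trans
    hin
  have e1 := Submodule.norm_sq_eq_add_norm_sq_starProjection μ K
  have e2 := norm_sub_sq (𝕜 := ℂ) (Kᗮ.starProjection s) (Kᗮ.starProjection μ)
  rw [← hQ] at e2
  have e3 : ‖K.starProjection μ‖ ^ 2 ≤ (C * t) ^ 2 := by gcongr
  have e4 : ‖Kᗮ.starProjection s‖ ^ 2 ≤ (S * t) ^ 2 := by gcongr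
  have e5 : 0 ≤ ‖K.starProjection μ‖ ^ 2 := by positivity
  have e6 : 0 ≤ ‖Kᗮ.starProjection s‖ ^ 2 := by positivity
  rw [e1, e2]
  simp only [RCLike.re_to_complex]
  rw [abs_le] at hre ⊢
  constructor <;> nlinarith [hre.1, hre.2]

lemma aux_main (b : ι → E) (α : E) (fc : ℝ) :
    ∃ C : ℝ, 0 < C ∧ ∃ ε > (0 : ℝ), ∀ (w : ι → ℂ) (t : ℝ), 0 ≤ t →
      (∀ j, ‖w j‖ * ‖inner ℂ (b j) (∑ i, w i • b i - α)‖ ^ 2 ≤ t ^ 3) →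
      |‖∑ i, w i • b i - α‖ ^ 2 - fc| < ε →
      |‖∑ i, w i • b i - α‖ ^ 2 - fc| ≤ C * t ^ 2 := by
  classical
  choose C hC0 hC using aux_J b α
  let F : Finset ι → ℝ := fun J =>
    ‖(Submodule.span ℂ (b '' (J : Set ι)))ᗮ.starProjection α‖ ^ 2
  have hε : ∃ ε > (0 : ℝ), ∀ J, F J ≠ fc → 2 * ε ≤ |F J - fc| := by
    have : ∀ J, ∃ e > (0 : ℝ), F J ≠ fc → 2 * e ≤ |F J - fc| := by
      intro J
      by_cases h : F J = fc
      · exact ⟨1, one_pos, fun h' => absurd h h'⟩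
      · exact ⟨|F J - fc| / 2, by have := abs_pos.2 (sub_ne_zero.2 h); positivity,
          fun _ => by linarith⟩
    choose e he he' using this
    refine ⟨Finset.univ.inf' Finset.univ_nonempty e, ?_, ?_⟩
    · simpa [Finset.lt_inf'_iff] using he
    · intro J hJ
      have := Finset.inf'_le e (Finset.mem_univ J)
      linarith [he' J hJ]
  obtain ⟨ε, hε0, hε⟩ := hε
  refine ⟨∑ J, C J + 1, by have := Finset.sum_nonneg fun J (_ : J ∈ Finset.univ) => hC0 J; linarith,
    ε, hε0, ?_⟩
  intro w t ht hG hlt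
  set μ := ∑ i, w i • b i - α with hμ
  let J : Finset ι := Finset.univ.filter fun j => ‖inner ℂ (b j) μ‖ ≤ t
  have key := hC J w t ht (fun j hj => (Finset.mem_filter.1 hj).2) (by
    intro j hj
    have hj' : t < ‖inner ℂ (b j) μ‖ := by simpa [J] using hj
    have hg := hG j
    rw [← hμ]
    generalize ‖inner ℂ (b j) μ‖ = c at *
    have hw := norm_nonneg (w j)
    generalize ‖w j‖ = a at *
    have hc : 0 < c := lt_of_le_of_lt ht hj'
    have h2 : a * c ≤ t ^ 2 := by
      by_contra hcon
      push Not at hcon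
      nlinarith [mul_lt_mul_of_pos_right hcon hc, mul_le_mul_of_nonneg_left hj'.le (sq_nonneg t)]
    refine ⟨?_, h2⟩
    by_contra hcon
    push Not at hcon
    nlinarith [mul_lt_mul_of_pos_right hcon hc, mul_le_mul_of_nonneg_left hj'.le ht])
  rw [← hμ] at key
  change |‖μ‖ ^ 2 - F J| ≤ _ at key
  have hCJ : C J * t ^ 2 ≤ (∑ J, C J + 1) * t ^ 2 := by
    have := Finset.single_le_sum (fun J (_ : J ∈ Finset.univ) => hC0 J) (Finset.mem_univ J)
    gcongr; linarith
  refine le_trans ?_ (key.trans hCJ)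
  by_cases h : F J = fc
  · rw [h]
  · have h1 := hε J h
    have h2 := abs_sub_le (F J) (‖μ‖ ^ 2) fc
    rw [abs_sub_comm (F J) (‖μ‖ ^ 2)] at h2
    linarith

end aux

lemma aux_grad {N : ℕ} {E : Type*} [NormedAddCommGroup E] [InnerProductSpace ℂ E]
    (b : Fin N → E) (α : E) (f : EuclideanSpace ℂ (Fin N ⊕ Fin N) → ℝ)
    (hf : ∀ z, f z = ‖∑ j, (z (Sum.inl j) * z (Sum.inr j)) • b j - α‖ ^ 2)
    (z : EuclideanSpace ℂ (Fin N ⊕ Fin N)) (j : Fin N) :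
    ‖z (Sum.inl j) * z (Sum.inr j)‖ *
      ‖inner ℂ (b j) (∑ j, (z (Sum.inl j) * z (Sum.inr j)) • b j - α)‖ ^ 2
      ≤ ‖gradient f z‖ ^ 2 := by
  letI : InnerProductSpace ℝ E := InnerProductSpace.rclikeToReal ℂ E
  set μ := ∑ j, (z (Sum.inl j) * z (Sum.inr j)) • b j - α with hμ
  set c : Fin N → ℂ := fun j => inner ℂ (b j) μ with hc
  have hnorm : ‖gradient f z‖ = ‖fderiv ℝ f z‖ := by
    simp [gradient]
  rw [hnorm]
  let v : EuclideanSpace ℂ (Fin N ⊕ Fin N) := WithLp.toLp 2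
    (Sum.elim (fun j => c j * star (z (Sum.inr j))) (fun j => c j * star (z (Sum.inl j))))
  have hv1 : ∀ j, v (Sum.inl j) = c j * star (z (Sum.inr j)) := fun j => rfl
  have hv2 : ∀ j, v (Sum.inr j) = c j * star (z (Sum.inl j)) := fun j => rfl
  have hdiff : DifferentiableAt ℝ f z := by
    have : f = fun z => ‖∑ j, (z (Sum.inl j) * z (Sum.inr j)) • b j - α‖ ^ 2 := funext hf
    rw [this]
    have hco : ∀ i : Fin N ⊕ Fin N,
        DifferentiableAt ℝ (fun z : EuclideanSpace ℂ (Fin N ⊕ Fin N) => z i) z := by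
      intro i
      exact ((EuclideanSpace.proj i : EuclideanSpace ℂ (Fin N ⊕ Fin N) →L[ℂ] ℂ).restrictScalars ℝ).differentiableAt
    refine DifferentiableAt.norm_sq ℂ (DifferentiableAt.sub_const ?_ _)
    refine DifferentiableAt.fun_sum fun j _ => ?_
    exact ((hco _).mul (hco _)).smul_const (b j)
  have hline : HasDerivAt (fun s : ℝ => z + s • v) v 0 := by
    simpa using ((hasDerivAt_id (0 : ℝ)).smul_const v).const_add z
  have hd1 : HasDerivAt (fun s : ℝ => f (z + s • v)) (fderiv ℝ f z v) 0 := by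
    have := HasFDerivAt.comp_hasDerivAt (l := f) (l' := fderiv ℝ f z) (0 : ℝ)
      (by simpa using hdiff.hasFDerivAt) hline
    exact this
  have hd2 : HasDerivAt (fun s : ℝ => f (z + s • v))
      (2 * inner ℝ μ (∑ j, (v (Sum.inl j) * z (Sum.inr j) + z (Sum.inl j) * v (Sum.inr j)) • b j))
      0 := by
    have hco : ∀ i : Fin N ⊕ Fin N,
        HasDerivAt (fun s : ℝ => (z + s • v) i) (v i) 0 := by
      intro i
      have := ((hasDerivAt_id (0 : ℝ)).smul_const (v i)).const_add (z i)
      simpa using this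
    have hs : HasDerivAt (fun s : ℝ =>
        ∑ j, ((z + s • v) (Sum.inl j) * (z + s • v) (Sum.inr j)) • b j - α)
        (∑ j, (v (Sum.inl j) * z (Sum.inr j) + z (Sum.inl j) * v (Sum.inr j)) • b j) 0 := by
      refine HasDerivAt.sub_const _ (HasDerivAt.fun_sum fun j _ => ?_)
      have := ((hco (Sum.inl j)).mul (hco (Sum.inr j))).smul_const (b j)
      simpa using this
    have := hs.norm_sq
    simp only [hf]
    simpa [hμ] using this
  have hval := hd1.unique hd2
  have hv : ‖v‖ ^ 2 = ∑ j, ‖c j‖ ^ 2 * (‖z (Sum.inl j)‖ ^ 2 + ‖z (Sum.inr j)‖ ^ 2) := by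
    rw [EuclideanSpace.norm_sq_eq, Fintype.sum_sum_type, ← Finset.sum_add_distrib]
    refine Finset.sum_congr rfl fun j _ => ?_
    rw [hv1, hv2]
    simp only [norm_mul, norm_star]
    ring
  have hin : inner ℝ μ
      (∑ j, (v (Sum.inl j) * z (Sum.inr j) + z (Sum.inl j) * v (Sum.inr j)) • b j) = ‖v‖ ^ 2 := by
    rw [hv, inner_sum]
    refine Finset.sum_congr rfl fun j _ => ?_
    rw [hv1, hv2, real_inner_eq_re_inner ℂ, inner_smul_right, ← inner_conj_symm]
    change Complex.re (_ * star (c j)) = _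
    have : (c j * star (z (Sum.inr j)) * z (Sum.inr j) +
        z (Sum.inl j) * (c j * star (z (Sum.inl j)))) * star (c j) =
        (c j * star (c j)) * (z (Sum.inl j) * star (z (Sum.inl j)) +
          z (Sum.inr j) * star (z (Sum.inr j))) := by ring
    rw [this]
    simp only [Complex.star_def, Complex.mul_conj']
    norm_cast
  rw [hin] at hval
  have hle : 2 * ‖v‖ ^ 2 ≤ ‖fderiv ℝ f z‖ * ‖v‖ := by
    rw [← hval]
    exact (le_abs_self _).trans ((fderiv ℝ f z).le_opNorm v)
  have hle2 : ‖v‖ ≤ ‖fderiv ℝ f z‖ := by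
    rcases (norm_nonneg v).eq_or_lt with h | h
    · rw [← h]; exact norm_nonneg _
    · nlinarith
  calc _ ≤ ‖c j‖ ^ 2 * (‖z (Sum.inl j)‖ ^ 2 + ‖z (Sum.inr j)‖ ^ 2) := by
        rw [norm_mul, mul_comm]
        refine mul_le_mul_of_nonneg_left ?_ (by positivity)
        nlinarith [sq_nonneg (‖z (Sum.inl j)‖ - ‖z (Sum.inr j)‖), sq_nonneg (‖z (Sum.inl j)‖), sq_nonneg (‖z (Sum.inr j)‖)]
    _ ≤ ‖v‖ ^ 2 := by
        rw [hv]
        exact Finset.single_le_sum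
          (f := fun j => ‖c j‖ ^ 2 * (‖z (Sum.inl j)‖ ^ 2 + ‖z (Sum.inr j)‖ ^ 2))
          (fun j _ => by positivity) (Finset.mem_univ j)
    _ ≤ _ := by gcongr


/-- **Global Łojasiewicz estimate for the norm-square of the complex moment map of a
linear torus action on `T*ℂᴺ = ℂᴺ × ℂᴺ`** (modelled as `EuclideanSpace ℂ (Fin N ⊕ Fin N)`,
with `x j = z (Sum.inl j)` and `y j = z (Sum.inr j)`).  With
`μ_c (x,y) = ∑ⱼ xⱼ yⱼ βⱼ - α_ℂ` and `f = ‖μ_c‖²`, for every `f_c ≥ 0` there are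
`k > 0` and `ε > 0` with `‖∇f (x,y)‖ ≥ k * |f (x,y) - f_c| ^ (3/4)` whenever
`|f (x,y) - f_c| < ε`. -/
theorem stmt_2
    (N r : ℕ) (hN : 1 ≤ N) (hr : 1 ≤ r)
    (β : Fin N → Fin r → ℝ) (αC : EuclideanSpace ℂ (Fin r))
    (μc : EuclideanSpace ℂ (Fin N ⊕ Fin N) → EuclideanSpace ℂ (Fin r))
    (hμc : ∀ z : EuclideanSpace ℂ (Fin N ⊕ Fin N), ∀ a : Fin r,
      μc z a = (∑ j, z (Sum.inl j) * z (Sum.inr j) * (β j a : ℂ)) - αC a)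
    (f : EuclideanSpace ℂ (Fin N ⊕ Fin N) → ℝ)
    (hf : ∀ z, f z = ‖μc z‖ ^ 2)
    (fc : ℝ) (hfc : 0 ≤ fc) :
    ∃ k > (0 : ℝ), ∃ ε > (0 : ℝ), ∀ z : EuclideanSpace ℂ (Fin N ⊕ Fin N),
      |f z - fc| < ε → k * |f z - fc| ^ (3 / 4 : ℝ) ≤ ‖gradient f z‖ := by

  let b : Fin N → EuclideanSpace ℂ (Fin r) := fun j => WithLp.toLp 2 fun a => (β j a : ℂ)
  have hμ : ∀ z, μc z = ∑ j, (z (Sum.inl j) * z (Sum.inr j)) • b j - αC := by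
    intro z
    ext a
    rw [hμc]
    simp [b]
  have hf' : ∀ z, f z = ‖∑ j, (z (Sum.inl j) * z (Sum.inr j)) • b j - αC‖ ^ 2 := by
    intro z
    rw [hf, hμ]
  obtain ⟨C, hC, ε, hε, H⟩ := aux_main b αC fc
  refine ⟨(C⁻¹) ^ (3 / 4 : ℝ), by positivity, ε, hε, fun z hz => ?_⟩
  have hg : 0 ≤ ‖gradient f z‖ := norm_nonneg _
  set g := ‖gradient f z‖ with hgdef
  have ht3 : (g ^ (2 / 3 : ℝ)) ^ 3 = g ^ 2 := by
    rw [← Real.rpow_natCast, ← Real.rpow_mul hg, ← Real.rpow_natCast]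
    norm_num
  have ht2 : ((g ^ (2 / 3 : ℝ)) ^ 2) ^ (3 / 4 : ℝ) = g := by
    rw [← Real.rpow_natCast, ← Real.rpow_mul hg, ← Real.rpow_mul hg]
    norm_num
  have key := H (fun j => z (Sum.inl j) * z (Sum.inr j)) (g ^ (2 / 3 : ℝ)) (by positivity)
    (fun j => by rw [ht3]; exact aux_grad b αC f hf' z j) (by rw [← hf']; exact hz)
  rw [← hf'] at key
  calc (C⁻¹) ^ (3 / 4 : ℝ) * |f z - fc| ^ (3 / 4 : ℝ)
      = (C⁻¹ * |f z - fc|) ^ (3 / 4 : ℝ) := by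
        rw [Real.mul_rpow (by positivity) (abs_nonneg _)]
    _ ≤ ((g ^ (2 / 3 : ℝ)) ^ 2) ^ (3 / 4 : ℝ) := by
        refine Real.rpow_le_rpow (by positivity) ?_ (by norm_num)
        rw [inv_mul_le_iff₀ hC]
        exact key
    _ = g := ht2
end

section
/- (Main Łojasiewicz estimate for the hyperkähler moment map of a torus.) Let f = ‖μ_r‖² + ‖μ_c‖² on ℂᴺ × ℂᴺ (the norm-square of the hyperkähler moment map μ_HK = (μ_r, μ_c)). For every f_c ≥ 0 there exist constants k > 0 and ε > 0 such that for all (x,y) ∈ ℂᴺ × ℂᴺ with |f(x,y) − f_c| < ε one has ‖∇f(x,y)‖ ≥ k·|f(x,y) − f_c|^{3/4}. -/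
section
open Filter Topology

theorem reduce_aux {ι V E : Type*} [Fintype ι] [NormedAddCommGroup V] [NormedSpace ℝ V]
    [FiniteDimensional ℝ V] [NormedAddCommGroup E] [NormedSpace ℝ E]
    (A : (ι → V) →L[ℝ] E) :
    ∃ C > (0:ℝ), ∀ g : ι → V, ∃ g' : ι → V, (∀ j, ‖g' j‖ ≤ ‖g j‖) ∧ A g' = A g ∧
      ∀ j, ‖g' j‖ ≤ C * ‖A g‖ := by
  classical
  let Mn : (ι → V) → Prop := fun g => ∀ g' : ι → V, (∀ j, ‖g' j‖ ≤ ‖g j‖) → A g' = A g →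
    ∀ j, ‖g' j‖ = ‖g j‖
  have : ProperSpace V := FiniteDimensional.proper ℝ V
  -- existence of minimal elements
  have hex : ∀ g : ι → V, ∃ g', (∀ j, ‖g' j‖ ≤ ‖g j‖) ∧ A g' = A g ∧ Mn g' := by
    intro g
    let K : Set (ι → V) := (Set.univ.pi fun j => Metric.closedBall (0:V) ‖g j‖) ∩ {h | A h = A g}
    have hK : IsCompact K := by
      apply IsCompact.inter_right
      · exact isCompact_univ_pi fun j => isCompact_closedBall _ _
      · exact isClosed_eq A.continuous continuous_const
    have hKm : ∀ h, h ∈ K ↔ (∀ j, ‖h j‖ ≤ ‖g j‖) ∧ A h = A g := by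
      intro h; simp [K, Set.mem_pi]
    obtain ⟨m, hm, hmin⟩ := hK.exists_isMinOn ⟨g, (hKm g).2 ⟨fun j => le_rfl, rfl⟩⟩
      (f := fun h => ∑ j, ‖h j‖) (by fun_prop)
    have hm' := (hKm m).1 hm
    refine ⟨m, hm'.1, hm'.2, ?_⟩
    intro g' hg' hA
    have h1 : ∑ j, ‖m j‖ ≤ ∑ j, ‖g' j‖ :=
      hmin ((hKm g').2 ⟨fun j => (hg' j).trans (hm'.1 j), hA.trans hm'.2⟩)
    have h2 : ∑ j, ‖g' j‖ = ∑ j, ‖m j‖ := le_antisymm (Finset.sum_le_sum fun j _ => hg' j) h1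
    intro j
    exact (Finset.sum_eq_sum_iff_of_le (fun j _ => hg' j)).1 h2 j (Finset.mem_univ j)
  have hscale : ∀ (c : ℝ) (g : ι → V), 0 < c → Mn g → Mn (c • g) := by
    intro c g hc hg g' hg' hA j
    have := hg (c⁻¹ • g') (fun j => by
      have := hg' j
      simp only [Pi.smul_apply, norm_smul, norm_inv, Real.norm_eq_abs, abs_of_pos hc] at this ⊢
      rwa [inv_mul_le_iff₀ hc]) (by rw [map_smul, hA, map_smul, inv_smul_smul₀ hc.ne']) j
    simp only [Pi.smul_apply, norm_smul, norm_inv, Real.norm_eq_abs, abs_of_pos hc] at this ⊢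
    rw [← this]; field_simp
  have hsph : IsCompact (Metric.sphere (0 : ι → V) 1) := isCompact_sphere _ _
  have key : ∃ c > (0:ℝ), ∀ g ∈ Metric.sphere (0 : ι → V) 1, Mn g → c ≤ ‖A g‖ := by
    refine hsph.induction_on (p := fun s => ∃ c > (0:ℝ), ∀ g ∈ s, Mn g → c ≤ ‖A g‖) ?_ ?_ ?_ ?_
    · exact ⟨1, one_pos, by simp⟩
    · rintro s t hst ⟨c, hc, h⟩; exact ⟨c, hc, fun g hg => h g (hst hg)⟩
    · rintro s t ⟨c, hc, h⟩ ⟨d, hd, h'⟩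
      refine ⟨min c d, lt_min hc hd, ?_⟩
      rintro g (hg | hg) hm
      · exact (min_le_left _ _).trans (h g hg hm)
      · exact (min_le_right _ _).trans (h' g hg hm)
    · intro u hu
      by_cases hAu : A u = 0
      · have hu0 : u ≠ 0 := by rintro rfl; simp at hu
        obtain ⟨j₀, hj₀⟩ := Function.ne_iff.1 hu0
        have hev : ∀ᶠ g in 𝓝 u, ∀ j, u j ≠ 0 → ‖g j - u j‖ < ‖g j‖ := by
          rw [eventually_all]
          intro j
          by_cases hj : u j = 0
          · simp [hj]
          · have hc1 : Continuous fun g : ι → V => ‖g j - u j‖ := by fun_prop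
            have hc2 : Continuous fun g : ι → V => ‖g j‖ := by fun_prop
            have := hc1.continuousAt.eventually_lt hc2.continuousAt (x₀ := u) (by simpa using hj)
            filter_upwards [this] with g hg _ using hg
        refine ⟨_, mem_nhdsWithin_of_mem_nhds hev, 1, one_pos, ?_⟩
        intro g hg hm
        exfalso
        have h1 := hm (g - u) (fun j => by
          by_cases hj : u j = 0
          · simp [hj]
          · exact (hg j hj).le) (by simp [hAu]) j₀
        exact (hg j₀ hj₀).ne h1
      · have hpos : 0 < ‖A u‖ := norm_pos_iff.2 hAu
        have hc1 : Continuous fun g : ι → V => ‖A g‖ := by fun_prop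
        have hev := (hc1.tendsto u).eventually_const_lt (half_lt_self hpos)
        exact ⟨_, mem_nhdsWithin_of_mem_nhds hev, ‖A u‖/2, half_pos hpos,
          fun g hg _ => le_of_lt hg⟩
  obtain ⟨c, hc, hkey⟩ := key
  refine ⟨c⁻¹, inv_pos.2 hc, fun g => ?_⟩
  obtain ⟨m, hm1, hm2, hm3⟩ := hex g
  refine ⟨m, hm1, hm2, fun j => (norm_le_pi_norm m j).trans ?_⟩
  rcases eq_or_ne m 0 with h0 | h0
  · rw [h0]; simp; positivity
  have hp : 0 < ‖m‖ := norm_pos_iff.2 h0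
  have := hkey (‖m‖⁻¹ • m) (by simp [norm_smul, hp.ne']) (hscale _ _ (inv_pos.2 hp) hm3)
  rw [map_smul, norm_smul, norm_inv, norm_norm, hm2] at this
  rw [inv_mul_eq_div, le_div_iff₀ hp] at this
  rw [inv_mul_eq_div, le_div_iff₀ hc]; linarith

theorem local_aux {ι V E : Type*} [Fintype ι] [NormedAddCommGroup V] [InnerProductSpace ℝ V]
    [FiniteDimensional ℝ V] [NormedAddCommGroup E] [InnerProductSpace ℝ E]
    (A : (ι → V) →L[ℝ] E) (B : ι → E →L[ℝ] V)
    (hAB : ∀ h e, inner ℝ (A h) e = ∑ j, inner ℝ (h j) (B j e))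
    (α : E) (hs : ι → V)
    (hcrit : ∑ j, ‖hs j‖ * ‖B j (A hs - α)‖ ^ 2 = 0) :
    ∃ C > (0:ℝ), ∀ᶠ h in 𝓝 hs, ∀ q : ℝ, 0 ≤ q →
      q ^ 3 = ∑ j, ‖h j‖ * ‖B j (A h - α)‖ ^ 2 →
      |‖A h - α‖ ^ 2 - ‖A hs - α‖ ^ 2| ≤ C * q ^ 2 := by
  classical
  obtain ⟨C₀, hC₀, hred⟩ := reduce_aux A
  set μs : E := A hs - α with hμs
  have hcrit' : ∀ j, hs j = 0 ∨ B j μs = 0 := by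
    intro j
    have := (Finset.sum_eq_zero_iff_of_nonneg (fun j _ => by positivity)).1 hcrit j
      (Finset.mem_univ j)
    rcases mul_eq_zero.1 this with h | h
    · left; simpa using h
    · right; simpa using h
  -- each term is bounded by q ^ 3
  have hterm : ∀ (h : ι → V) (q : ℝ), q ^ 3 = ∑ j, ‖h j‖ * ‖B j (A h - α)‖ ^ 2 → ∀ j,
      ‖h j‖ * ‖B j (A h - α)‖ ^ 2 ≤ q ^ 3 := by
    intro h q hq j
    rw [hq]
    exact Finset.single_le_sum (f := fun j => ‖h j‖ * ‖B j (A h - α)‖ ^ 2)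
      (fun j _ => by positivity) (Finset.mem_univ j)
  have hcG : Continuous fun h : ι → V => ∑ j, ‖h j‖ * ‖B j (A h - α)‖ ^ 2 := by fun_prop
  -- q ≤ 1 eventually
  have hq1 : ∀ᶠ h in 𝓝 hs, ∀ q : ℝ, 0 ≤ q →
      q ^ 3 = ∑ j, ‖h j‖ * ‖B j (A h - α)‖ ^ 2 → q ≤ 1 := by
    have := (hcG.tendsto hs).eventually_lt_const (u := 1) (by
      change ∑ j, ‖hs j‖ * ‖B j (A hs - α)‖ ^ 2 < 1
      rw [hcrit]; exact one_pos)
    filter_upwards [this] with h hh q hq0 hq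
    by_contra hcon
    push Not at hcon
    have : 1 < q ^ 3 := one_lt_pow₀ hcon (by norm_num)
    linarith
  have hw1 : ∀ᶠ h in 𝓝 hs, ‖A (h - hs)‖ < 1 := by
    have hc : Continuous fun h : ι → V => ‖A (h - hs)‖ := by fun_prop
    exact (hc.tendsto hs).eventually_lt_const (by simp)
  -- T bound
  have hT : ∃ K ≥ (0:ℝ), ∀ᶠ h in 𝓝 hs, ∀ q : ℝ, 0 ≤ q →
      q ^ 3 = ∑ j, ‖h j‖ * ‖B j (A h - α)‖ ^ 2 → ∀ j, B j μs ≠ 0 → ‖h j‖ ≤ K * q ^ 3 := by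
    have : ∀ j, ∃ K ≥ (0:ℝ), ∀ᶠ h in 𝓝 hs, ∀ q : ℝ, 0 ≤ q →
        q ^ 3 = ∑ j, ‖h j‖ * ‖B j (A h - α)‖ ^ 2 → B j μs ≠ 0 → ‖h j‖ ≤ K * q ^ 3 := by
      intro j
      by_cases hj : B j μs = 0
      · exact ⟨0, le_rfl, Eventually.of_forall fun h q _ _ h' => absurd hj h'⟩
      have hpos : 0 < ‖B j μs‖ ^ 2 := by positivity
      have hc : Continuous fun h : ι → V => ‖B j (A h - α)‖ ^ 2 := by fun_prop
      refine ⟨(‖B j μs‖ ^ 2 / 2)⁻¹, by positivity, ?_⟩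
      filter_upwards [(hc.tendsto hs).eventually_const_lt (half_lt_self hpos)] with h hh q hq0 hq _
      have := hterm h q hq j
      rw [inv_mul_eq_div, le_div_iff₀ (half_pos hpos)]
      exact (mul_le_mul_of_nonneg_left hh.le (norm_nonneg _)).trans this
    choose K hK0 hK using this
    refine ⟨∑ j, K j, Finset.sum_nonneg fun j _ => hK0 j, ?_⟩
    filter_upwards [eventually_all.2 hK] with h hh q hq0 hq j hj
    refine (hh j q hq0 hq hj).trans ?_
    gcongr
    exact Finset.single_le_sum (f := K) (fun j _ => hK0 j) (Finset.mem_univ j)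
  obtain ⟨KT, hKT0, hKT⟩ := hT
  let C₁ : ℝ := ‖A‖ * KT
  have hC₁ : 0 ≤ C₁ := by positivity
  -- per-term bound
  have hterms : ∀ j, ∃ K ≥ (0:ℝ), ∀ᶠ h in 𝓝 hs, ∀ q : ℝ, 0 ≤ q →
      q ^ 3 = ∑ j, ‖h j‖ * ‖B j (A h - α)‖ ^ 2 → ∀ s : V,
      ‖s‖ ≤ C₀ * (‖A (h - hs)‖ + C₁ * q ^ 3) → ‖s‖ ≤ ‖h j - hs j‖ → (B j μs ≠ 0 → s = 0) →
      inner ℝ ((if B j μs = 0 then 0 else h j) + s) (B j (A (h - hs))) ≤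
        K * ((‖A (h - hs)‖ + q) * q) := by
    intro j
    by_cases hj : B j μs = 0
    · -- B j w = v_j
      have hv : ∀ h : ι → V, B j (A (h - hs)) = B j (A h - α) := by
        intro h
        have : A h - α = A (h - hs) + μs := by rw [hμs, map_sub]; abel
        rw [this, map_add, hj, add_zero]
      -- enough: bound on squares
      have suff : ∀ D ≥ (0:ℝ), ∀ (s v : V) (Y : ℝ), 0 ≤ Y → (‖s‖ * ‖v‖) ^ 2 ≤ D * Y ^ 2 →
          inner ℝ s v ≤ (D + 1) * Y := by
        intro D hD s v Y hY hle
        refine (real_inner_le_norm s v).trans ?_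
        refine abs_le_of_sq_le_sq' ?_ (by positivity) |>.2
        refine hle.trans ?_
        rw [mul_pow]
        have : D ≤ (D + 1) ^ 2 := by nlinarith
        gcongr
      by_cases hz : hs j = 0
      · -- D case
        refine ⟨C₀ * (1 + C₁) + 1, by positivity, ?_⟩
        filter_upwards [hq1] with h hq1 q hq0 hq s hs1 hs2 _
        have hq1 := hq1 q hq0 hq
        simp only [hj, if_true, zero_add]
        rw [hv]
        apply suff _ (by positivity) _ _ _ (by positivity)
        rw [hz, sub_zero] at hs2
        have hp := norm_nonneg (A (h - hs))
        set p := ‖A (h - hs)‖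
        have hq31 : q ^ 3 ≤ q := by
          calc q ^ 3 = q * q ^ 2 := by ring
            _ ≤ q * 1 := by gcongr; exact pow_le_one₀ hq0 hq1
            _ = q := mul_one q
        have hX : ‖s‖ ≤ C₀ * (1 + C₁) * (p + q) := by
          refine hs1.trans ?_
          rw [mul_assoc C₀]
          refine mul_le_mul_of_nonneg_left ?_ hC₀.le
          nlinarith [mul_nonneg hC₁ hp, mul_le_mul_of_nonneg_left hq31 hC₁]
        calc (‖s‖ * ‖B j (A h - α)‖) ^ 2 = ‖s‖ * (‖s‖ * ‖B j (A h - α)‖ ^ 2) := by ring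
          _ ≤ ‖s‖ * (‖h j‖ * ‖B j (A h - α)‖ ^ 2) := by gcongr
          _ ≤ (C₀ * (1 + C₁) * (p + q)) * q ^ 3 := by
            gcongr
            exact hterm h q hq j
          _ = (C₀ * (1 + C₁)) * ((p + q) * q * q ^ 2) := by ring
          _ ≤ (C₀ * (1 + C₁)) * ((p + q) * (p + q) * q ^ 2) := by gcongr; linarith
          _ = (C₀ * (1 + C₁)) * ((p + q) * q) ^ 2 := by ring
      · -- Z case
        have hpos : 0 < ‖hs j‖ := norm_pos_iff.2 hz
        have hc : Continuous fun h : ι → V => ‖h j‖ := by fun_prop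
        refine ⟨(C₀ * (1 + C₁)) ^ 2 * (‖hs j‖ / 2)⁻¹ + 1, by positivity, ?_⟩
        filter_upwards [hq1, (hc.tendsto hs).eventually_const_lt (half_lt_self hpos)]
          with h hq1 hh q hq0 hq s hs1 hs2 _
        have hq1 := hq1 q hq0 hq
        simp only [hj, if_true, zero_add]
        rw [hv]
        apply suff _ (by positivity) _ _ _ (by positivity)
        have hp := norm_nonneg (A (h - hs))
        set p := ‖A (h - hs)‖
        have hq31 : q ^ 3 ≤ q := by
          calc q ^ 3 = q * q ^ 2 := by ring
            _ ≤ q * 1 := by gcongr; exact pow_le_one₀ hq0 hq1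
            _ = q := mul_one q
        have hX : ‖s‖ ≤ C₀ * (1 + C₁) * (p + q) := by
          refine hs1.trans ?_
          rw [mul_assoc C₀]
          refine mul_le_mul_of_nonneg_left ?_ hC₀.le
          nlinarith [mul_nonneg hC₁ hp, mul_le_mul_of_nonneg_left hq31 hC₁]
        have hvv : ‖B j (A h - α)‖ ^ 2 ≤ (‖hs j‖ / 2)⁻¹ * q ^ 2 := by
          rw [inv_mul_eq_div, le_div_iff₀ (half_pos hpos)]
          calc ‖B j (A h - α)‖ ^ 2 * (‖hs j‖ / 2) ≤ ‖B j (A h - α)‖ ^ 2 * ‖h j‖ := by gcongr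
            _ ≤ q ^ 3 := by rw [mul_comm]; exact hterm h q hq j
            _ ≤ q ^ 2 := pow_le_pow_of_le_one hq0 hq1 (by norm_num)
        calc (‖s‖ * ‖B j (A h - α)‖) ^ 2 = ‖s‖ ^ 2 * ‖B j (A h - α)‖ ^ 2 := by ring
          _ ≤ (C₀ * (1 + C₁) * (p + q)) ^ 2 * ((‖hs j‖ / 2)⁻¹ * q ^ 2) := by gcongr
          _ = _ := by ring
    · refine ⟨KT * ‖B j‖, by positivity, ?_⟩
      filter_upwards [hq1, hw1, hKT] with h hq1 hw1 hKT q hq0 hq s _ _ hs3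
      have hq1 := hq1 q hq0 hq
      rw [hs3 hj, add_zero, if_neg hj]
      have hp := norm_nonneg (A (h - hs))
      calc inner ℝ (h j) (B j (A (h - hs))) ≤ ‖h j‖ * ‖B j (A (h - hs))‖ := real_inner_le_norm _ _
        _ ≤ (KT * q ^ 3) * (‖B j‖ * 1) := by
          gcongr
          · exact hKT q hq0 hq j hj
          · exact ((B j).le_opNorm _).trans (by gcongr)
        _ ≤ (KT * q ^ 2) * (‖B j‖ * 1) := by
          refine mul_le_mul_of_nonneg_right (mul_le_mul_of_nonneg_left ?_ hKT0) (by positivity)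
          exact pow_le_pow_of_le_one hq0 hq1 (by norm_num)
        _ = KT * ‖B j‖ * (q * q) := by ring
        _ ≤ KT * ‖B j‖ * ((‖A (h - hs)‖ + q) * q) := by
          gcongr
          linarith
  choose K hK0 hK using hterms
  set L : ℝ := ∑ j, K j with hL
  have hL0 : 0 ≤ L := Finset.sum_nonneg fun j _ => hK0 j
  set M : ℝ := ∑ j, KT * ‖B j μs‖ with hM
  have hM0 : 0 ≤ M := Finset.sum_nonneg fun j _ => by positivity
  refine ⟨2 * M + (L + 1) ^ 2, by positivity, ?_⟩
  filter_upwards [eventually_all.2 hK, hq1, hw1, hKT] with h hK hq1 hw1 hKT q hq0 hq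
  have hq1 := hq1 q hq0 hq
  have hKT := hKT q hq0 hq
  have hq32 : q ^ 3 ≤ q ^ 2 := pow_le_pow_of_le_one hq0 hq1 (by norm_num)
  set p := ‖A (h - hs)‖ with hp
  have hp0 : 0 ≤ p := norm_nonneg _
  -- decomposition
  let hT : ι → V := fun j => if B j μs = 0 then 0 else h j
  let g : ι → V := fun j => if B j μs = 0 then h j - hs j else 0
  have hsplit : h - hs = hT + g := by
    funext j
    by_cases hj : B j μs = 0
    · simp [hT, g, hj]
    · simp [hT, g, hj, (hcrit' j).resolve_right hj]
  obtain ⟨g', hg1, hg2, hg3⟩ := hred g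
  have hAT : ‖A hT‖ ≤ C₁ * q ^ 3 := by
    refine (A.le_opNorm _).trans ?_
    rw [mul_assoc]
    gcongr
    refine (pi_norm_le_iff_of_nonneg (by positivity)).2 fun j => ?_
    by_cases hj : B j μs = 0
    · simp only [hT, hj, if_true, norm_zero]; positivity
    · simp only [hT, hj, if_false]; exact hKT j hj
  have hAg : ‖A g‖ ≤ p + C₁ * q ^ 3 := by
    have : A g = A (h - hs) - A hT := by rw [hsplit, map_add]; abel
    rw [this]
    exact (norm_sub_le _ _).trans (by gcongr)
  have hw : A (h - hs) = A (hT + g') := by rw [hsplit, map_add, map_add, hg2]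
  have hpsq : p ^ 2 ≤ L * ((p + q) * q) := by
    calc p ^ 2 = inner ℝ (A (hT + g')) (A (h - hs)) := by
          rw [← hw, real_inner_self_eq_norm_sq]
      _ = ∑ j, inner ℝ (hT j + g' j) (B j (A (h - hs))) := hAB _ _
      _ ≤ ∑ j, K j * ((p + q) * q) := by
        refine Finset.sum_le_sum fun j _ => ?_
        refine hK j q hq0 hq (g' j) ?_ ?_ ?_
        · exact (hg3 j).trans (by gcongr)
        · refine (hg1 j).trans ?_
          by_cases hj : B j μs = 0
          · simp [g, hj]
          · simp [g, hj]
        · intro hj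
          have := hg1 j
          simpa [g, hj] using this
      _ = L * ((p + q) * q) := by rw [hL, Finset.sum_mul]
  have hpq : p ≤ (L + 1) * q := by
    by_contra hcon
    push Not at hcon
    have h1 : 0 < p := lt_of_le_of_lt (by positivity) hcon
    nlinarith [mul_lt_mul_of_pos_left hcon h1, mul_le_mul_of_nonneg_left hcon.le hq0,
      mul_nonneg hL0 hq0, mul_nonneg hq0 hq0]
  have hlin : |inner ℝ (A (h - hs)) μs| ≤ M * q ^ 2 := by
    rw [hAB, hM, Finset.sum_mul]
    refine (Finset.abs_sum_le_sum_abs _ _).trans (Finset.sum_le_sum fun j _ => ?_)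
    by_cases hj : B j μs = 0
    · simp [hj]
    · have h0 := (hcrit' j).resolve_right hj
      rw [Pi.sub_apply, h0, sub_zero]
      refine (abs_real_inner_le_norm _ _).trans ?_
      have := (hKT j hj).trans (mul_le_mul_of_nonneg_left hq32 hKT0)
      calc ‖h j‖ * ‖B j μs‖ ≤ KT * q ^ 2 * ‖B j μs‖ := by gcongr
        _ = _ := by ring
  have hexp : ‖A h - α‖ ^ 2 - ‖μs‖ ^ 2 = 2 * inner ℝ (A (h - hs)) μs + p ^ 2 := by
    have : A h - α = A (h - hs) + μs := by rw [hμs, map_sub]; abel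
    rw [this, norm_add_sq_real]; ring
  rw [hexp]
  have hp2 : p ^ 2 ≤ (L + 1) ^ 2 * q ^ 2 := by
    rw [← mul_pow]; gcongr
  have h2 := abs_le.1 hlin
  rw [abs_le]
  constructor <;> nlinarith [sq_nonneg p, mul_nonneg (sq_nonneg (L+1)) (sq_nonneg q)]

theorem global_aux {ι V E : Type*} [Fintype ι] [NormedAddCommGroup V] [InnerProductSpace ℝ V]
    [FiniteDimensional ℝ V] [NormedAddCommGroup E] [InnerProductSpace ℝ E]
    (A : (ι → V) →L[ℝ] E) (B : ι → E →L[ℝ] V)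
    (hAB : ∀ h e, inner ℝ (A h) e = ∑ j, inner ℝ (h j) (B j e))
    (α : E) (fc : ℝ) :
    ∃ c > (0:ℝ), ∃ ε > (0:ℝ), ∀ h : ι → V, |‖A h - α‖ ^ 2 - fc| < ε →
      c * |‖A h - α‖ ^ 2 - fc| ^ (3 / 2 : ℝ) ≤ ∑ j, ‖h j‖ * ‖B j (A h - α)‖ ^ 2 := by
  have : ProperSpace V := FiniteDimensional.proper ℝ V
  obtain ⟨C₀, hC₀, hred⟩ := reduce_aux A
  let R : ℝ := C₀ * (√(fc + 1) + ‖α‖)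
  have hR : 0 ≤ R := by positivity
  have hcF : Continuous fun h : ι → V => |‖A h - α‖ ^ 2 - fc| := by fun_prop
  have hcG : Continuous fun h : ι → V => ∑ j, ‖h j‖ * ‖B j (A h - α)‖ ^ 2 := by fun_prop
  have key : ∃ c > (0:ℝ), ∃ ε > (0:ℝ), ∀ h ∈ Metric.closedBall (0 : ι → V) R,
      |‖A h - α‖ ^ 2 - fc| < ε →
      c * |‖A h - α‖ ^ 2 - fc| ^ (3 / 2 : ℝ) ≤ ∑ j, ‖h j‖ * ‖B j (A h - α)‖ ^ 2 := by
    refine (isCompact_closedBall (0 : ι → V) R).induction_on (p := fun s =>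
      ∃ c > (0:ℝ), ∃ ε > (0:ℝ), ∀ h ∈ s, |‖A h - α‖ ^ 2 - fc| < ε →
      c * |‖A h - α‖ ^ 2 - fc| ^ (3 / 2 : ℝ) ≤ ∑ j, ‖h j‖ * ‖B j (A h - α)‖ ^ 2) ?_ ?_ ?_ ?_
    · exact ⟨1, one_pos, 1, one_pos, by simp⟩
    · rintro s t hst ⟨c, hc, ε, hε, h⟩
      exact ⟨c, hc, ε, hε, fun x hx => h x (hst hx)⟩
    · rintro s t ⟨c, hc, ε, hε, h⟩ ⟨d, hd, δ, hδ, h'⟩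
      refine ⟨min c d, lt_min hc hd, min ε δ, lt_min hε hδ, ?_⟩
      rintro x (hx | hx) hxx
      · refine le_trans ?_ (h x hx (hxx.trans_le (min_le_left _ _)))
        gcongr
        exact min_le_left _ _
      · refine le_trans ?_ (h' x hx (hxx.trans_le (min_le_right _ _)))
        gcongr
        exact min_le_right _ _
    · intro hs _
      by_cases hF : |‖A hs - α‖ ^ 2 - fc| = 0
      · by_cases hG : ∑ j, ‖hs j‖ * ‖B j (A hs - α)‖ ^ 2 = 0
        · obtain ⟨C, hC, hev⟩ := local_aux A B hAB α hs hG
          refine ⟨_, mem_nhdsWithin_of_mem_nhds hev, (C ^ (3 / 2 : ℝ))⁻¹, by positivity, 1,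
            one_pos, ?_⟩
          intro h hh _
          have hfc : fc = ‖A hs - α‖ ^ 2 := by
            have := abs_eq_zero.1 hF; linarith
          set G := ∑ j, ‖h j‖ * ‖B j (A h - α)‖ ^ 2 with hGdef
          have hG0 : 0 ≤ G := Finset.sum_nonneg fun j _ => by positivity
          have hq3 : (G ^ (1 / 3 : ℝ)) ^ 3 = G := by
            rw [← Real.rpow_natCast, ← Real.rpow_mul hG0]; norm_num
          have h1 := hh (G ^ (1 / 3 : ℝ)) (by positivity) hq3
          rw [← hfc] at h1
          rw [inv_mul_eq_div, div_le_iff₀ (by positivity)]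
          calc |‖A h - α‖ ^ 2 - fc| ^ (3 / 2 : ℝ) ≤ (C * (G ^ (1 / 3 : ℝ)) ^ 2) ^ (3 / 2 : ℝ) := by
                gcongr
            _ = G * C ^ (3 / 2 : ℝ) := by
              rw [Real.mul_rpow hC.le (by positivity), mul_comm, ← Real.rpow_natCast,
                ← Real.rpow_mul hG0, ← Real.rpow_mul hG0]
              norm_num
        · have hGpos : 0 < ∑ j, ‖hs j‖ * ‖B j (A hs - α)‖ ^ 2 :=
            lt_of_le_of_ne (Finset.sum_nonneg fun j _ => by positivity) (Ne.symm hG)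
          have hev := (hcG.tendsto hs).eventually_const_lt (half_lt_self hGpos)
          refine ⟨_, mem_nhdsWithin_of_mem_nhds hev, _, half_pos hGpos, 1, one_pos, ?_⟩
          intro h hh h1
          refine le_trans ?_ (le_of_lt hh)
          refine mul_le_of_le_one_right (half_pos hGpos).le ?_
          exact Real.rpow_le_one (abs_nonneg _) h1.le (by norm_num)
      · have hpos : 0 < |‖A hs - α‖ ^ 2 - fc| := lt_of_le_of_ne (abs_nonneg _) (Ne.symm hF)
        have hev := (hcF.tendsto hs).eventually_const_lt (half_lt_self hpos)
        refine ⟨_, mem_nhdsWithin_of_mem_nhds hev, 1, one_pos, _, half_pos hpos, ?_⟩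
        intro h hh h1
        exact absurd (lt_trans hh h1) (lt_irrefl _)
  obtain ⟨c, hc, ε, hε, hkey⟩ := key
  refine ⟨c, hc, min ε 1, lt_min hε one_pos, ?_⟩
  intro h hh
  obtain ⟨h', h1, h2, h3⟩ := hred h
  have hb : ‖A h‖ ≤ √(fc + 1) + ‖α‖ := by
    have : ‖A h - α‖ ≤ √(fc + 1) := by
      apply Real.le_sqrt_of_sq_le
      have := (abs_lt.1 (hh.trans_le (min_le_right _ _))).2
      linarith
    calc ‖A h‖ = ‖(A h - α) + α‖ := by rw [sub_add_cancel]
      _ ≤ _ := (norm_add_le _ _).trans (by gcongr)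
  have := hkey h' (by
    rw [mem_closedBall_zero_iff, pi_norm_le_iff_of_nonneg hR]
    exact fun j => (h3 j).trans (mul_le_mul_of_nonneg_left hb hC₀.le)) (by
    rw [h2]; exact hh.trans_le (min_le_left _ _))
  rw [h2] at this
  refine this.trans (Finset.sum_le_sum fun j _ => ?_)
  have := h1 j
  gcongr

noncomputable def hkA (N r : ℕ) (β : Fin N → Fin r → ℝ) :
    (Fin N → WithLp 2 (ℝ × ℂ)) →L[ℝ]
      WithLp 2 (EuclideanSpace ℝ (Fin r) × EuclideanSpace ℂ (Fin r)) :=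
  LinearMap.toContinuousLinearMap
    { toFun := fun h => WithLp.toLp 2 (WithLp.toLp 2 fun a => ∑ j, (h j).fst * β j a,
        WithLp.toLp 2 fun a => ∑ j, (h j).snd * (β j a : ℂ))
      map_add' := by
        intro h h'
        apply WithLp.ofLp_injective
        ext a <;> simp [add_mul, Finset.sum_add_distrib]
      map_smul' := by
        intro c h
        apply WithLp.ofLp_injective
        ext a <;> simp [mul_assoc, Finset.mul_sum] }

noncomputable def hkB (N r : ℕ) (β : Fin N → Fin r → ℝ) (j : Fin N) :
    WithLp 2 (EuclideanSpace ℝ (Fin r) × EuclideanSpace ℂ (Fin r)) →L[ℝ] WithLp 2 (ℝ × ℂ) :=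
  LinearMap.toContinuousLinearMap
    { toFun := fun e => WithLp.toLp 2 (∑ a, e.fst a * β j a, ∑ a, e.snd a * (β j a : ℂ))
      map_add' := by
        intro h h'
        apply WithLp.ofLp_injective
        ext <;> simp [add_mul, Finset.sum_add_distrib]
      map_smul' := by
        intro c h
        apply WithLp.ofLp_injective
        ext <;> simp [mul_assoc, Finset.mul_sum] }

theorem hkAB (N r : ℕ) (β : Fin N → Fin r → ℝ) (h : Fin N → WithLp 2 (ℝ × ℂ))
    (e : WithLp 2 (EuclideanSpace ℝ (Fin r) × EuclideanSpace ℂ (Fin r))) :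
    inner ℝ (hkA N r β h) e = ∑ j, inner ℝ (h j) (hkB N r β j e) := by
  simp only [hkA, hkB, LinearMap.coe_toContinuousLinearMap', LinearMap.coe_mk, AddHom.coe_mk,
    WithLp.prod_inner_apply, PiLp.inner_apply, Finset.sum_add_distrib, sum_inner, inner_sum]
  congr 1
  · rw [Finset.sum_comm]
    refine Finset.sum_congr rfl fun j _ => Finset.sum_congr rfl fun a _ => ?_
    simp; ring
  · rw [Finset.sum_comm]
    refine Finset.sum_congr rfl fun j _ => Finset.sum_congr rfl fun a _ => ?_
    simp [Complex.inner]; ring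

/-- gradient computation -/
theorem grad_aux
    (N r : ℕ)
    (β : Fin N → Fin r → ℝ)
    (αR : EuclideanSpace ℝ (Fin r)) (αC : EuclideanSpace ℂ (Fin r))
    (μr : EuclideanSpace ℂ (Fin N ⊕ Fin N) → EuclideanSpace ℝ (Fin r))
    (hμr : ∀ z : EuclideanSpace ℂ (Fin N ⊕ Fin N), ∀ a : Fin r,
      μr z a = (1 / 2 : ℝ) * (∑ j, (‖z (Sum.inl j)‖ ^ 2 - ‖z (Sum.inr j)‖ ^ 2) * β j a)
        - αR a)
    (μc : EuclideanSpace ℂ (Fin N ⊕ Fin N) → EuclideanSpace ℂ (Fin r))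
    (hμc : ∀ z : EuclideanSpace ℂ (Fin N ⊕ Fin N), ∀ a : Fin r,
      μc z a = (∑ j, z (Sum.inl j) * z (Sum.inr j) * (β j a : ℂ)) - αC a)
    (f : EuclideanSpace ℂ (Fin N ⊕ Fin N) → ℝ)
    (hf : ∀ z, f z = ‖μr z‖ ^ 2 + ‖μc z‖ ^ 2) (z : EuclideanSpace ℂ (Fin N ⊕ Fin N)) :
    4 * ∑ j, (‖z (Sum.inl j)‖ ^ 2 + ‖z (Sum.inr j)‖ ^ 2) *
      ((∑ a, μr z a * β j a) ^ 2 + ‖∑ a, μc z a * (β j a : ℂ)‖ ^ 2) ≤ ‖gradient f z‖ ^ 2 := by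
  let s : Fin N → ℝ := fun j => ∑ a, μr z a * β j a
  let t : Fin N → ℂ := fun j => ∑ a, μc z a * (β j a : ℂ)
  let g : EuclideanSpace ℂ (Fin N ⊕ Fin N) := WithLp.toLp 2 (Sum.elim
    (fun j => 2 * ((s j : ℂ) * z (Sum.inl j) + t j * star (z (Sum.inr j))))
    (fun j => 2 * (-(s j : ℂ) * z (Sum.inr j) + t j * star (z (Sum.inl j)))))
  have hf' : f = fun z => ∑ a, (μr z a) ^ 2 + ∑ a, ((μc z a).re ^ 2 + (μc z a).im ^ 2) := by
    funext z
    rw [hf, EuclideanSpace.norm_sq_eq, EuclideanSpace.norm_sq_eq]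
    simp [Complex.sq_norm, Complex.normSq_apply, ← pow_two]
  have hgn : ‖g‖ ^ 2 = 4 * ∑ j, (‖z (Sum.inl j)‖ ^ 2 + ‖z (Sum.inr j)‖ ^ 2) *
      ((∑ a, μr z a * β j a) ^ 2 + ‖∑ a, μc z a * (β j a : ℂ)‖ ^ 2) := by
    rw [EuclideanSpace.norm_sq_eq, Fintype.sum_sum_type, ← Finset.sum_add_distrib, Finset.mul_sum]
    refine Finset.sum_congr rfl fun j _ => ?_
    change ‖2 * ((s j : ℂ) * z (Sum.inl j) + t j * star (z (Sum.inr j)))‖ ^ 2 + 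
      ‖2 * (-(s j : ℂ) * z (Sum.inr j) + t j * star (z (Sum.inl j)))‖ ^ 2 = 
      4 * ((‖z (Sum.inl j)‖ ^ 2 + ‖z (Sum.inr j)‖ ^ 2) * (s j ^ 2 + ‖t j‖ ^ 2))
    simp only [Complex.sq_norm, Complex.normSq_apply]
    simp
    ring
  have hre : ∀ z a, (μc z a).re = (∑ j, ((z (Sum.inl j)).re * (z (Sum.inr j)).re
      - (z (Sum.inl j)).im * (z (Sum.inr j)).im) * β j a) - (αC a).re := by
    intro z a; rw [hμc]; simp
  have him : ∀ z a, (μc z a).im = (∑ j, ((z (Sum.inl j)).re * (z (Sum.inr j)).im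
      + (z (Sum.inl j)).im * (z (Sum.inr j)).re) * β j a) - (αC a).im := by
    intro z a; rw [hμc]; simp
  have hrr : ∀ z a, μr z a = (1 / 2 : ℝ) * (∑ j, (((z (Sum.inl j)).re ^ 2
      + (z (Sum.inl j)).im ^ 2) - ((z (Sum.inr j)).re ^ 2 + (z (Sum.inr j)).im ^ 2)) * β j a)
        - αR a := by
    intro z a; rw [hμr]; simp [Complex.sq_norm, Complex.normSq_apply, ← pow_two]
  have hreD : ∀ k, Differentiable ℝ fun z : EuclideanSpace ℂ (Fin N ⊕ Fin N) => (z k).re := by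
    intro k
    exact Complex.reCLM.differentiable.comp (by fun_prop)
  have himD : ∀ k, Differentiable ℝ fun z : EuclideanSpace ℂ (Fin N ⊕ Fin N) => (z k).im := by
    intro k
    exact Complex.imCLM.differentiable.comp (by fun_prop)
  have hdiff : Differentiable ℝ f := by
    rw [hf']
    simp only [hre, him, hrr]
    fun_prop
  have hline : HasDerivAt (fun τ : ℝ => f (z + τ • g)) (‖g‖ ^ 2) 0 := by
    have e1 : ∀ k, HasDerivAt (fun τ : ℝ => ((z + τ • g) k).re) (g k).re 0 := by
      intro k
      have : (fun τ : ℝ => ((z + τ • g) k).re) = fun τ : ℝ => (z k).re + τ * (g k).re := by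
        funext τ; simp
      rw [this]
      simpa using ((hasDerivAt_id (0:ℝ)).mul_const (g k).re).const_add (z k).re
    have e2 : ∀ k, HasDerivAt (fun τ : ℝ => ((z + τ • g) k).im) (g k).im 0 := by
      intro k
      have : (fun τ : ℝ => ((z + τ • g) k).im) = fun τ : ℝ => (z k).im + τ * (g k).im := by
        funext τ; simp
      rw [this]
      simpa using ((hasDerivAt_id (0:ℝ)).mul_const (g k).im).const_add (z k).im
    have d1 : ∀ a, HasDerivAt (fun τ : ℝ => μr (z + τ • g) a)
        (∑ j, ((z (Sum.inl j)).re * (g (Sum.inl j)).re + (z (Sum.inl j)).im * (g (Sum.inl j)).im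
          - (z (Sum.inr j)).re * (g (Sum.inr j)).re - (z (Sum.inr j)).im * (g (Sum.inr j)).im)
            * β j a) 0 := by
      intro a
      simp only [hrr]
      have := ((HasDerivAt.fun_sum (u := Finset.univ) fun (j : Fin N) _ =>
        ((((e1 (Sum.inl j)).fun_pow 2).fun_add ((e2 (Sum.inl j)).fun_pow 2)).fun_sub
          (((e1 (Sum.inr j)).fun_pow 2).fun_add ((e2 (Sum.inr j)).fun_pow 2))).mul_const (β j a)).const_mul
            (1 / 2 : ℝ)).sub_const (αR a)
      refine this.congr_deriv (Eq.symm ?_)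
      rw [Finset.mul_sum]
      refine Finset.sum_congr rfl fun j _ => ?_
      simp; ring
    have d2 : ∀ a, HasDerivAt (fun τ : ℝ => (μc (z + τ • g) a).re)
        (∑ j, ((g (Sum.inl j)).re * (z (Sum.inr j)).re + (z (Sum.inl j)).re * (g (Sum.inr j)).re
          - ((g (Sum.inl j)).im * (z (Sum.inr j)).im + (z (Sum.inl j)).im * (g (Sum.inr j)).im))
            * β j a) 0 := by
      intro a
      simp only [hre]
      have := (HasDerivAt.fun_sum (u := Finset.univ) fun (j : Fin N) _ =>
        (((e1 (Sum.inl j)).fun_mul (e1 (Sum.inr j))).fun_sub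
          ((e2 (Sum.inl j)).fun_mul (e2 (Sum.inr j)))).mul_const (β j a)).sub_const (αC a).re
      refine this.congr_deriv (Eq.symm ?_)
      simp
    have d3 : ∀ a, HasDerivAt (fun τ : ℝ => (μc (z + τ • g) a).im)
        (∑ j, ((g (Sum.inl j)).re * (z (Sum.inr j)).im + (z (Sum.inl j)).re * (g (Sum.inr j)).im
          + ((g (Sum.inl j)).im * (z (Sum.inr j)).re + (z (Sum.inl j)).im * (g (Sum.inr j)).re))
            * β j a) 0 := by
      intro a
      simp only [him]
      have := (HasDerivAt.fun_sum (u := Finset.univ) fun (j : Fin N) _ =>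
        (((e1 (Sum.inl j)).fun_mul (e2 (Sum.inr j))).fun_add
          ((e2 (Sum.inl j)).fun_mul (e1 (Sum.inr j)))).mul_const (β j a)).sub_const (αC a).im
      refine this.congr_deriv (Eq.symm ?_)
      simp
    rw [hf']
    have := (HasDerivAt.fun_sum (u := Finset.univ) fun (a : Fin r) _ => (d1 a).fun_pow 2).fun_add
      (HasDerivAt.fun_sum (u := Finset.univ) fun (a : Fin r) _ =>
        ((d2 a).fun_pow 2).fun_add ((d3 a).fun_pow 2))
    refine this.congr_deriv (Eq.symm ?_)
    simp only [zero_smul, add_zero]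
    rw [← Finset.sum_add_distrib]
    simp only [Finset.mul_sum, ← Finset.sum_add_distrib]
    rw [Finset.sum_comm, EuclideanSpace.norm_sq_eq, Fintype.sum_sum_type, ← Finset.sum_add_distrib]
    refine Finset.sum_congr rfl fun j _ => ?_
    have hs : s j = ∑ a, μr z a * β j a := rfl
    have htr : (t j).re = ∑ a, (μc z a).re * β j a := by simp [t]
    have hti : (t j).im = ∑ a, (μc z a).im * β j a := by simp [t]
    have g1r : (g (Sum.inl j)).re = 2 * (s j * (z (Sum.inl j)).re + ((t j).re * (z (Sum.inr j)).re
      + (t j).im * (z (Sum.inr j)).im)) := by simp [g]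
    have g1i : (g (Sum.inl j)).im = 2 * (s j * (z (Sum.inl j)).im + ((t j).im * (z (Sum.inr j)).re
      - (t j).re * (z (Sum.inr j)).im)) := by simp [g]; ring
    have g2r : (g (Sum.inr j)).re = 2 * (-s j * (z (Sum.inr j)).re + ((t j).re * (z (Sum.inl j)).re
      + (t j).im * (z (Sum.inl j)).im)) := by simp [g]
    have g2i : (g (Sum.inr j)).im = 2 * (-s j * (z (Sum.inr j)).im + ((t j).im * (z (Sum.inl j)).re
      - (t j).re * (z (Sum.inl j)).im)) := by simp [g]; ring
    simp only [Complex.sq_norm, Complex.normSq_apply]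
    generalize (g (Sum.inl j)).re = G1 at *
    generalize (g (Sum.inl j)).im = G2 at *
    generalize (g (Sum.inr j)).re = G3 at *
    generalize (g (Sum.inr j)).im = G4 at *
    trans 2 * (s j * ((z (Sum.inl j)).re * G1 + (z (Sum.inl j)).im * G2
          - (z (Sum.inr j)).re * G3 - (z (Sum.inr j)).im * G4)
        + (t j).re * (G1 * (z (Sum.inr j)).re + (z (Sum.inl j)).re * G3
          - (G2 * (z (Sum.inr j)).im + (z (Sum.inl j)).im * G4))
        + (t j).im * (G1 * (z (Sum.inr j)).im + (z (Sum.inl j)).re * G4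
          + (G2 * (z (Sum.inr j)).re + (z (Sum.inl j)).im * G3)))
    · rw [g1r, g1i, g2r, g2i]; ring
    · rw [hs, htr, hti]
      simp only [Finset.sum_mul, ← Finset.sum_add_distrib, Finset.mul_sum]
      refine Finset.sum_congr rfl fun a _ => ?_
      simp; ring
  have hinner : inner ℝ (gradient f z) g = ‖g‖ ^ 2 := by
    have h1 : HasFDerivAt f (fderiv ℝ f z) (z + (0:ℝ) • g) := by
      simpa using (hdiff z).hasFDerivAt
    have h2 : HasDerivAt (fun τ : ℝ => z + τ • g) g 0 := by
      simpa using ((hasDerivAt_id (0:ℝ)).smul_const g).const_add z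
    have h3 := h1.comp_hasDerivAt (0:ℝ) h2
    have h4 := h3.unique hline
    rw [← h4, gradient, InnerProductSpace.toDual_symm_apply]
  rw [← hgn]
  have h5 : ‖g‖ ^ 2 ≤ ‖gradient f z‖ * ‖g‖ := hinner ▸ real_inner_le_norm _ _
  have h6 : ‖g‖ ≤ ‖gradient f z‖ := by
    by_contra hcon
    push Not at hcon
    nlinarith [norm_nonneg (gradient f z), norm_nonneg g]
  gcongr

end

/-- **Global Łojasiewicz estimate for the norm-square of the hyperkähler moment map of a
linear torus action on `T*ℂᴺ = ℂᴺ × ℂᴺ`** (modelled as `EuclideanSpace ℂ (Fin N ⊕ Fin N)`,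
with `x j = z (Sum.inl j)` and `y j = z (Sum.inr j)`).  With
`μ_r (x,y) = (1/2) ∑ⱼ (|xⱼ|² - |yⱼ|²) βⱼ - α_ℝ`, `μ_c (x,y) = ∑ⱼ xⱼ yⱼ βⱼ - α_ℂ` and
`f = ‖μ_r‖² + ‖μ_c‖²`, for every `f_c ≥ 0` there are `k > 0` and `ε > 0` with
`‖∇f (x,y)‖ ≥ k * |f (x,y) - f_c| ^ (3/4)` whenever `|f (x,y) - f_c| < ε`. -/
theorem stmt_3
    (N r : ℕ) (hN : 1 ≤ N) (hr : 1 ≤ r)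
    (β : Fin N → Fin r → ℝ)
    (αR : EuclideanSpace ℝ (Fin r)) (αC : EuclideanSpace ℂ (Fin r))
    (μr : EuclideanSpace ℂ (Fin N ⊕ Fin N) → EuclideanSpace ℝ (Fin r))
    (hμr : ∀ z : EuclideanSpace ℂ (Fin N ⊕ Fin N), ∀ a : Fin r,
      μr z a = (1 / 2 : ℝ) * (∑ j, (‖z (Sum.inl j)‖ ^ 2 - ‖z (Sum.inr j)‖ ^ 2) * β j a)
        - αR a)
    (μc : EuclideanSpace ℂ (Fin N ⊕ Fin N) → EuclideanSpace ℂ (Fin r))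
    (hμc : ∀ z : EuclideanSpace ℂ (Fin N ⊕ Fin N), ∀ a : Fin r,
      μc z a = (∑ j, z (Sum.inl j) * z (Sum.inr j) * (β j a : ℂ)) - αC a)
    (f : EuclideanSpace ℂ (Fin N ⊕ Fin N) → ℝ)
    (hf : ∀ z, f z = ‖μr z‖ ^ 2 + ‖μc z‖ ^ 2)
    (fc : ℝ) (hfc : 0 ≤ fc) :
    ∃ k > (0 : ℝ), ∃ ε > (0 : ℝ), ∀ z : EuclideanSpace ℂ (Fin N ⊕ Fin N),
      |f z - fc| < ε → k * |f z - fc| ^ (3 / 4 : ℝ) ≤ ‖gradient f z‖ := by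
  obtain ⟨c, hc, ε, hε, H⟩ := global_aux (hkA N r β) (hkB N r β) (hkAB N r β)
    (WithLp.toLp 2 (αR, αC)) fc
  refine ⟨√(8 * c), by positivity, ε, hε, fun z hz => ?_⟩
  let h : Fin N → WithLp 2 (ℝ × ℂ) := fun j =>
    WithLp.toLp 2 ((1 / 2 : ℝ) * (‖z (Sum.inl j)‖ ^ 2 - ‖z (Sum.inr j)‖ ^ 2),
      z (Sum.inl j) * z (Sum.inr j))
  have hA : hkA N r β h - WithLp.toLp 2 (αR, αC) = WithLp.toLp 2 (μr z, μc z) := by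
    apply WithLp.ofLp_injective
    ext a
    · simp [hkA, h, hμr, Finset.mul_sum, mul_assoc]
    · simp [hkA, h, hμc]
  have hfz : ‖hkA N r β h - WithLp.toLp 2 (αR, αC)‖ ^ 2 = f z := by
    rw [hA, hf, WithLp.prod_norm_sq_eq_of_L2]
    rfl
  have hn : ∀ j, ‖h j‖ = (1 / 2 : ℝ) * (‖z (Sum.inl j)‖ ^ 2 + ‖z (Sum.inr j)‖ ^ 2) := by
    intro j
    rw [← sq_eq_sq₀ (norm_nonneg _) (by positivity), WithLp.prod_norm_sq_eq_of_L2]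
    change ‖(1 / 2 : ℝ) * (‖z (Sum.inl j)‖ ^ 2 - ‖z (Sum.inr j)‖ ^ 2)‖ ^ 2
      + ‖z (Sum.inl j) * z (Sum.inr j)‖ ^ 2 = _
    rw [norm_mul (z (Sum.inl j)), Real.norm_eq_abs, sq_abs]
    ring
  have hB : ∀ j, ‖hkB N r β j (hkA N r β h - WithLp.toLp 2 (αR, αC))‖ ^ 2 =
      (∑ a, μr z a * β j a) ^ 2 + ‖∑ a, μc z a * (β j a : ℂ)‖ ^ 2 := by
    intro j
    rw [hA, WithLp.prod_norm_sq_eq_of_L2]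
    simp [hkB]
  have h1 := H h (by rw [hfz]; exact hz)
  rw [hfz] at h1
  have h2 := grad_aux N r β αR αC μr hμr μc hμc f hf z
  have h3 : 8 * (c * |f z - fc| ^ (3 / 2 : ℝ)) ≤ ‖gradient f z‖ ^ 2 := by
    refine le_trans (mul_le_mul_of_nonneg_left h1 (by norm_num)) (le_trans (le_of_eq ?_) h2)
    rw [Finset.mul_sum, Finset.mul_sum]
    refine Finset.sum_congr rfl fun j _ => ?_
    rw [hn, hB]; ring
  refine (abs_le_of_sq_le_sq' (le_trans (le_of_eq ?_) h3) (norm_nonneg _)).2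
  rw [mul_pow, Real.sq_sqrt (by positivity), ← Real.rpow_natCast, ← Real.rpow_mul (abs_nonneg _)]
  norm_num
  ring
end

section
/- (Flow-closedness conjecture of Jeffrey–Kiem–Kirwan, torus case.) Let f = ‖μ_c‖² on ℂᴺ × ℂᴺ. Then f is flow-closed: for every differentiable curve z : [0,∞) → ℂᴺ × ℂᴺ satisfying z'(t) = −∇f(z(t)) for all t ≥ 0, the limit lim_{t→∞} z(t) exists; in particular {z(t) : t ≥ 0} is contained in a compact subset of ℂᴺ × ℂᴺ. -/
lemma keyJ {H : Type*} [NormedAddCommGroup H] [InnerProductSpace ℂ H] [FiniteDimensional ℂ H]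
    {N : ℕ} (b : Fin N → H) (α : H) (J : Finset (Fin N)) :
    ∃ s C : ℝ, 0 ≤ C ∧ ∀ (p : Fin N → ℂ) (m : H) (e : ℝ), m = ∑ j, p j • b j - α → 0 ≤ e →
      (∀ j ∈ J, ‖inner ℂ (b j) m‖ ≤ e) →
      (∀ j ∉ J, ‖p j‖ ≤ e ∧ ‖p j‖ * ‖inner ℂ (b j) m‖ ≤ e ^ 2) → |‖m‖ ^ 2 - s| ≤ C * e ^ 2 := by
  classical
  set V : Submodule ℂ H := Submodule.span ℂ (b '' (J : Set (Fin N))) with hV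
  have hbV : ∀ j ∈ J, b j ∈ V := fun j hj => Submodule.subset_span ⟨j, hj, rfl⟩
  -- the anti-Lipschitz bound
  obtain ⟨A, hA0, hA⟩ : ∃ A : ℝ, 0 ≤ A ∧ ∀ v ∈ V, ∀ e : ℝ, 0 ≤ e →
      (∀ j ∈ J, ‖inner ℂ (b j) v‖ ≤ e) → ‖v‖ ≤ A * e := by
    let L : V →ₗ[ℂ] (Fin N → ℂ) :=
      LinearMap.pi fun j => if j ∈ J then (innerSL ℂ (b j)).toLinearMap ∘ₗ V.subtype else 0
    have hL : ∀ (v : V) j, L v j = if j ∈ J then inner ℂ (b j) (v : H) else 0 := by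
      intro v j
      by_cases hj : j ∈ J <;> simp [L, hj]
    have hker : LinearMap.ker L = ⊥ := by
      rw [LinearMap.ker_eq_bot']
      intro v hv
      have h1 : ∀ j ∈ J, inner ℂ (b j) (v : H) = 0 := by
        intro j hj
        have := congrFun hv j
        rw [hL] at this
        simpa [hj] using this
      have h2 : (v : H) ∈ Vᗮ := by
        rw [Submodule.mem_orthogonal]
        intro u hu
        rw [hV] at hu
        induction hu using Submodule.span_induction with
        | mem x hx => obtain ⟨j, hj, rfl⟩ := hx; exact h1 j hj
        | zero => simp
        | add x y _ _ hx hy => rw [inner_add_left, hx, hy, add_zero]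
        | smul c x _ hx => rw [inner_smul_left, hx, mul_zero]
      have h3 : inner ℂ (v : H) (v : H) = 0 := (Submodule.mem_orthogonal _ _).1 h2 v v.2
      exact Subtype.ext (inner_self_eq_zero.1 h3)
    obtain ⟨K, -, hK⟩ := L.exists_antilipschitzWith hker
    refine ⟨K, K.2, fun v hv e he h => ?_⟩
    have h4 := hK.le_mul_dist ⟨v, hv⟩ 0
    rw [map_zero, dist_zero_right, dist_zero_right] at h4
    refine h4.trans (mul_le_mul_of_nonneg_left ?_ K.2)
    rw [pi_norm_le_iff_of_nonneg he]
    intro j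
    rw [hL]
    by_cases hj : j ∈ J
    · simpa [hj] using h j hj
    · simpa [hj] using he
  set P := V.starProjection with hP
  set M : ℝ := ∑ j, ‖b j‖ with hM
  have hM0 : 0 ≤ M := Finset.sum_nonneg fun _ _ => norm_nonneg _
  refine ⟨‖α - P α‖ ^ 2, A ^ 2 + 2 * (N + M * A) + M ^ 2, by positivity, ?_⟩
  intro p m e hm he h1 h2
  set u := P m with hu
  set n := m - u with hn
  set w := n + (α - P α) with hw
  have huV : u ∈ V := V.starProjection_apply_mem m
  have hnV : n ∈ Vᗮ := V.sub_starProjection_mem_orthogonal m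
  have hnV' : ∀ v ∈ V, inner ℂ v n = 0 := (Submodule.mem_orthogonal _ _).1 hnV
  have hmu : m = u + n := by rw [hn]; abel
  have hue : ‖u‖ ≤ A * e := by
    refine hA u huV e he fun j hj => ?_
    have := h1 j hj
    rwa [hmu, inner_add_right, hnV' _ (hbV j hj), add_zero] at this
  have hm2 : ‖m‖ ^ 2 = ‖u‖ ^ 2 + ‖n‖ ^ 2 := by
    rw [hmu, @norm_add_sq ℂ, hnV' u huV]; simp
  have hw1 : w = ∑ j, p j • (b j - P (b j)) := by
    have : ∑ j, p j • (b j - P (b j)) = (m + α) - P (m + α) := by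
      rw [hm]; simp [smul_sub]
    rw [this, hw, hn, hu, map_add]; abel
  have hPb : ∀ j ∈ J, P (b j) = b j := fun j hj => V.starProjection_eq_self_iff.2 (hbV j hj)
  have hsub : ∀ x : H, ‖x - P x‖ ≤ ‖x‖ := by
    intro x
    have h0 : inner ℂ (P x) (x - P x) = 0 :=
      (Submodule.mem_orthogonal _ _).1 (V.sub_starProjection_mem_orthogonal x) _
        (V.starProjection_apply_mem x)
    have : ‖x‖ ^ 2 = ‖P x‖ ^ 2 + ‖x - P x‖ ^ 2 := by
      conv_lhs => rw [show x = P x + (x - P x) by abel]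
      rw [@norm_add_sq ℂ, h0]; simp
    nlinarith [norm_nonneg x, norm_nonneg (x - P x), sq_nonneg ‖P x‖]
  have hwM : ‖w‖ ≤ M * e := by
    rw [hw1, hM, Finset.sum_mul]
    refine (norm_sum_le _ _).trans (Finset.sum_le_sum fun j _ => ?_)
    rw [norm_smul]
    by_cases hj : j ∈ J
    · rw [hPb j hj]; simp; positivity
    · rw [mul_comm]
      exact mul_le_mul (hsub _) (h2 j hj).1 (norm_nonneg _) (norm_nonneg _)
  have hwn : ‖inner ℂ w n‖ ≤ (N + M * A) * e ^ 2 := by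
    have hs : ((N : ℝ) + M * A) * e ^ 2 = ∑ j : Fin N, (1 + ‖b j‖ * A) * e ^ 2 := by
      rw [← Finset.sum_mul, Finset.sum_add_distrib, ← Finset.sum_mul]; simp [hM]
    rw [hw1, sum_inner, hs]
    refine (norm_sum_le _ _).trans (Finset.sum_le_sum fun j _ => ?_)
    by_cases hj : j ∈ J
    · rw [hPb j hj]; simp; positivity
    · rw [inner_smul_left, inner_sub_left, hnV' _ (V.starProjection_apply_mem (b j)), sub_zero,
        norm_mul, RCLike.norm_conj]
      have h3 : ‖inner ℂ (b j) n‖ ≤ ‖inner ℂ (b j) m‖ + ‖b j‖ * (A * e) := by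
        rw [hn, inner_sub_right]
        refine (norm_sub_le _ _).trans (add_le_add le_rfl ((norm_inner_le_norm _ _).trans ?_))
        exact mul_le_mul_of_nonneg_left hue (norm_nonneg _)
      obtain ⟨h4, h5⟩ := h2 j hj
      calc ‖p j‖ * ‖inner ℂ (b j) n‖
          ≤ ‖p j‖ * (‖inner ℂ (b j) m‖ + ‖b j‖ * (A * e)) :=
            mul_le_mul_of_nonneg_left h3 (norm_nonneg _)
        _ = ‖p j‖ * ‖inner ℂ (b j) m‖ + ‖p j‖ * (‖b j‖ * (A * e)) := by ring
        _ ≤ e ^ 2 + e * (‖b j‖ * (A * e)) :=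
            add_le_add h5 (mul_le_mul_of_nonneg_right h4 (by positivity))
        _ = _ := by ring
  have hs : ‖α - P α‖ ^ 2 = ‖w‖ ^ 2 - 2 * RCLike.re (inner ℂ w n) + ‖n‖ ^ 2 := by
    rw [← @norm_sub_sq ℂ, hw]; congr 2; abel
  have hre := (RCLike.abs_re_le_norm (inner ℂ w n)).trans hwn
  have hu2 : ‖u‖ ^ 2 ≤ A ^ 2 * e ^ 2 := by
    rw [← mul_pow]; exact pow_le_pow_left₀ (norm_nonneg _) hue 2
  have hw2 : ‖w‖ ^ 2 ≤ M ^ 2 * e ^ 2 := by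
    rw [← mul_pow]; exact pow_le_pow_left₀ (norm_nonneg _) hwM 2
  rw [hm2, hs, abs_le]
  rw [abs_le] at hre
  constructor <;> nlinarith [sq_nonneg ‖u‖, sq_nonneg ‖w‖, sq_nonneg (A*e), sq_nonneg (M*e)]

lemma key {H : Type*} [NormedAddCommGroup H] [InnerProductSpace ℂ H] [FiniteDimensional ℂ H]
    {N : ℕ} (b : Fin N → H) (α : H) :
    ∃ (s : Finset (Fin N) → ℝ) (C : ℝ), 0 ≤ C ∧ ∀ (p : Fin N → ℂ) (m : H) (e : ℝ),
      m = ∑ j, p j • b j - α → 0 ≤ e →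
      ∑ j, ‖p j‖ * ‖inner ℂ (b j) m‖ ^ 2 ≤ e ^ 3 → ∃ J, |‖m‖ ^ 2 - s J| ≤ C * e ^ 2 := by
  classical
  choose s C hC h using keyJ b α
  refine ⟨s, ∑ J, C J, Finset.sum_nonneg fun J _ => hC J, fun p m e hm he hE => ?_⟩
  let J : Finset (Fin N) := Finset.univ.filter fun j => ‖inner ℂ (b j) m‖ ≤ e
  refine ⟨J, (h J p m e hm he (fun j hj => (Finset.mem_filter.1 hj).2) fun j hj => ?_).trans ?_⟩
  · have h1 : e < ‖inner ℂ (b j) m‖ := by simpa [J] using hj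
    have h2 : ‖p j‖ * ‖inner ℂ (b j) m‖ ^ 2 ≤ e ^ 3 :=
      (Finset.single_le_sum (f := fun j => ‖p j‖ * ‖inner ℂ (b j) m‖ ^ 2)
        (fun i _ => by positivity) (Finset.mem_univ j)).trans hE
    set k := ‖inner ℂ (b j) m‖
    have hk : 0 < k := he.trans_lt h1
    constructor
    · refine le_of_mul_le_mul_right (h2.trans ?_) (pow_pos hk 2)
      rw [pow_succ' e 2]
      exact mul_le_mul_of_nonneg_left (pow_le_pow_left₀ he h1.le 2) he
    · refine le_of_mul_le_mul_right ?_ hk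
      calc ‖p j‖ * k * k = ‖p j‖ * k ^ 2 := by ring
        _ ≤ e ^ 3 := h2
        _ = e ^ 2 * e := by ring
        _ ≤ e ^ 2 * k := mul_le_mul_of_nonneg_left h1.le (by positivity)
  · exact mul_le_mul_of_nonneg_right
      (Finset.single_le_sum (f := C) (fun J _ => hC J) (Finset.mem_univ J)) (by positivity)

lemma flow_conv {E : Type*} [NormedAddCommGroup E] [NormedSpace ℝ E] [CompleteSpace E]
    {ι : Type*} [Finite ι] (z v : ℝ → E) (g : ℝ → ℝ)
    (hz : ∀ t : ℝ, 0 ≤ t → HasDerivWithinAt z (v t) (Set.Ici 0) t)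
    (hg : ∀ t : ℝ, 0 ≤ t → HasDerivWithinAt g (-‖v t‖ ^ 2) (Set.Ici 0) t)
    (hg0 : ∀ t : ℝ, 0 ≤ t → 0 ≤ g t)
    (s : ι → ℝ) (C : ℝ) (hC : 0 ≤ C)
    (hkey : ∀ t : ℝ, 0 ≤ t → ∀ e : ℝ, 0 ≤ e → ‖v t‖ ^ 2 ≤ e ^ 3 → ∃ J, |g t - s J| ≤ C * e ^ 2) :
    ∃ L, Filter.Tendsto z Filter.atTop (nhds L) := by
  have hzc : ContinuousOn z (Set.Ici 0) := fun t ht => (hz t ht).continuousWithinAt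
  have hgc : ContinuousOn g (Set.Ici 0) := fun t ht => (hg t ht).continuousWithinAt
  have hanti : AntitoneOn g (Set.Ici 0) := by
    refine antitoneOn_of_hasDerivWithinAt_nonpos (f' := fun t => -‖v t‖ ^ 2) (convex_Ici 0) hgc ?_ ?_
    · intro x hx
      exact (hg x (interior_subset hx)).mono interior_subset
    · intro x _
      simp
  -- the limit of `g`
  obtain ⟨a, ha, hale⟩ : ∃ a, Filter.Tendsto g Filter.atTop (nhds a) ∧ ∀ t, 0 ≤ t → a ≤ g t := by
    let G : ℝ → ℝ := fun t => g (max t 0)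
    have hG : Antitone G := fun x y hxy =>
      hanti (Set.mem_Ici.2 (le_max_right _ _)) (Set.mem_Ici.2 (le_max_right _ _)) (max_le_max hxy le_rfl)
    have hb : BddBelow (Set.range G) := ⟨0, by rintro _ ⟨t, rfl⟩; exact hg0 _ (le_max_right _ _)⟩
    refine ⟨⨅ i, G i, (tendsto_atTop_ciInf hG hb).congr' ?_, fun t ht => ?_⟩
    · filter_upwards [Filter.eventually_ge_atTop 0] with t ht
      simp [G, max_eq_left ht]
    · have := ciInf_le hb t
      simpa [G, max_eq_left ht] using this
  have hloj : ∀ᶠ t in Filter.atTop, ∀ e : ℝ, 0 ≤ e → ‖v t‖ ^ 2 ≤ e ^ 3 → g t - a ≤ C * e ^ 2 := by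
    have h1 : ∀ J, ∀ᶠ t in Filter.atTop, s J ≠ a → |g t - a| ≤ |s J - a| / 2 := by
      intro J
      by_cases hJ : s J = a
      · simp [hJ]
      · have hpos : 0 < |s J - a| / 2 := by have := abs_pos.2 (sub_ne_zero.2 hJ); linarith
        filter_upwards [Metric.tendsto_nhds.1 ha _ hpos] with t ht _
        rw [Real.dist_eq] at ht
        exact ht.le
    filter_upwards [Filter.eventually_all.2 h1, Filter.eventually_ge_atTop 0] with t h2 ht e he hv
    obtain ⟨J, hJ⟩ := hkey t ht e he hv
    by_cases hJa : s J = a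
    · rw [hJa] at hJ
      exact (le_abs_self _).trans hJ
    · have h3 := h2 J hJa
      have h4 : |s J - a| ≤ |g t - s J| + |g t - a| := by
        have := abs_sub_le (s J) (g t) a
        rwa [abs_sub_comm (s J) (g t)] at this
      have := le_abs_self (g t - a)
      linarith
  obtain ⟨T, hT⟩ := Filter.eventually_atTop.1 (hloj.and (Filter.eventually_ge_atTop 0))
  by_cases hzero : ∃ T', 0 ≤ T' ∧ g T' = a
  · obtain ⟨T', hT'0, hT'⟩ := hzero
    refine ⟨z T', tendsto_const_nhds.congr' ?_⟩
    have hga : ∀ t, T' ≤ t → g t = a := fun t ht =>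
      le_antisymm (hT' ▸ hanti hT'0 (hT'0.trans ht) ht) (hale t (hT'0.trans ht))
    have hv0 : ∀ t, T' ≤ t → v t = 0 := by
      intro t ht
      have h1 : HasDerivWithinAt g (-‖v t‖ ^ 2) (Set.Ici t) t :=
        (hg t (hT'0.trans ht)).mono (Set.Ici_subset_Ici.2 (hT'0.trans ht))
      have h2 : HasDerivWithinAt g 0 (Set.Ici t) t :=
        (hasDerivWithinAt_const t (Set.Ici t) a).congr (fun x hx => hga x (ht.trans hx)) (hga t ht)
      have h3 := (uniqueDiffOn_Ici t t Set.self_mem_Ici).eq_deriv _ h1 h2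
      simpa using h3
    filter_upwards [Filter.eventually_ge_atTop T'] with t ht
    refine (constant_of_has_deriv_right_zero (a := T') (b := t)
      (hzc.mono fun x hx => hT'0.trans hx.1) ?_ t ⟨ht, le_rfl⟩).symm
    intro x hx
    have := (hz x (hT'0.trans hx.1)).mono (Set.Ici_subset_Ici.2 (hT'0.trans hx.1))
    rwa [hv0 x hx.1] at this
  · push Not at hzero
    have hpos : ∀ t, 0 ≤ t → 0 < g t - a := fun t ht =>
      sub_pos.2 (lt_of_le_of_ne (hale t ht) (hzero t ht).symm)
    set D : ℝ := C ^ (3 / 4 : ℝ) with hD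
    have hD0 : 0 ≤ D := Real.rpow_nonneg hC _
    have hDv : ∀ t, T ≤ t → (g t - a) ^ (3 / 4 : ℝ) ≤ D * ‖v t‖ := by
      intro t ht
      obtain ⟨h1, h2⟩ := hT t ht
      have h3 := h1 (‖v t‖ ^ (2 / 3 : ℝ)) (by positivity) (by
        rw [← Real.rpow_natCast (‖v t‖ ^ (2 / 3 : ℝ)), ← Real.rpow_mul (norm_nonneg _),
          ← Real.rpow_natCast]
        norm_num)
      have h4 := Real.rpow_le_rpow (hpos t h2).le h3 (by norm_num : (0 : ℝ) ≤ 3 / 4)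
      refine h4.trans (le_of_eq ?_)
      rw [Real.mul_rpow hC (by positivity), ← Real.rpow_natCast (‖v t‖ ^ (2 / 3 : ℝ)),
        ← Real.rpow_mul (norm_nonneg _), ← Real.rpow_mul (norm_nonneg _)]
      norm_num
      exact Or.inl rfl
    have hT0 : 0 ≤ T := (hT T le_rfl).2
    have hdist : ∀ S t, T ≤ S → S ≤ t → ‖z t - z S‖ ≤ 4 * D * (g S - a) ^ (1 / 4 : ℝ) := by
      intro S t hS hSt
      have hS0 := hT0.trans hS
      have hBd : ∀ x, S ≤ x → HasDerivWithinAt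
          (fun x => 4 * D * (g S - a) ^ (1 / 4 : ℝ) - 4 * D * (g x - a) ^ (1 / 4 : ℝ))
          (-(4 * D * (-‖v x‖ ^ 2 * (1 / 4) * (g x - a) ^ (1 / 4 - 1 : ℝ)))) (Set.Ici 0) x := by
        intro x hx
        exact ((((hg x (hS0.trans hx)).sub_const a).rpow_const
          (Or.inl (hpos x (hS0.trans hx)).ne')).const_mul (4 * D)).const_sub _
      have := image_norm_le_of_norm_deriv_right_le_deriv_boundary' (a := S) (b := t)
        (f := fun x => z x - z S) (f' := v)
        (B := fun x => 4 * D * (g S - a) ^ (1 / 4 : ℝ) - 4 * D * (g x - a) ^ (1 / 4 : ℝ))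
        (B' := fun x => -(4 * D * (-‖v x‖ ^ 2 * (1 / 4) * (g x - a) ^ (1 / 4 - 1 : ℝ))))
        ((hzc.mono fun x hx => hS0.trans hx.1).sub continuousOn_const)
        (fun x hx => ((hz x (hS0.trans hx.1)).mono
          (Set.Ici_subset_Ici.2 (hS0.trans hx.1))).sub_const _)
        (by simp)
        (fun x hx => (hBd x hx.1).continuousWithinAt.mono fun y hy => hS0.trans hy.1)
        (fun x hx => (hBd x hx.1).mono (Set.Ici_subset_Ici.2 (hS0.trans hx.1)))
        (fun x hx => by
          have h1 := hDv x (hS.trans hx.1)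
          have h2 := hpos x (hS0.trans hx.1)
          have h3 : (g x - a) ^ (1 / 4 - 1 : ℝ) = ((g x - a) ^ (3 / 4 : ℝ))⁻¹ := by
            rw [← Real.rpow_neg h2.le]; norm_num
          rw [h3]
          have h4 : 0 < (g x - a) ^ (3 / 4 : ℝ) := Real.rpow_pos_of_pos h2 _
          have h5 : -(4 * D * (-‖v x‖ ^ 2 * (1 / 4) * ((g x - a) ^ (3 / 4 : ℝ))⁻¹))
            = D * ‖v x‖ ^ 2 / (g x - a) ^ (3 / 4 : ℝ) := by ring
          rw [h5, le_div_iff₀ h4]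
          nlinarith [norm_nonneg (v x)])
        (x := t) ⟨hSt, le_rfl⟩
      have h6 : 0 ≤ 4 * D * (g t - a) ^ (1 / 4 : ℝ) :=
        mul_nonneg (by positivity) (Real.rpow_nonneg (hpos t (hS0.trans hSt)).le _)
      linarith
    have hlim : Filter.Tendsto (fun S => 4 * D * (g S - a) ^ (1 / 4 : ℝ)) Filter.atTop (nhds 0) := by
      have h1 : Filter.Tendsto (fun S => g S - a) Filter.atTop (nhds 0) := by
        simpa using ha.sub_const a
      have h2 := (h1.rpow_const (p := (1 / 4 : ℝ)) (Or.inr (by norm_num))).const_mul (4 * D)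
      rw [Real.zero_rpow (by norm_num), mul_zero] at h2
      exact h2
    refine cauchySeq_tendsto_of_complete (Metric.cauchySeq_iff'.2 fun ε hε => ?_)
    obtain ⟨S, hSε, hS⟩ :=
      ((hlim.eventually (gt_mem_nhds hε)).and (Filter.eventually_ge_atTop T)).exists
    refine ⟨S, fun n hn => ?_⟩
    rw [dist_eq_norm]
    exact (hdist S n hS hn).trans_lt hSε

lemma inner_real_eq {ι : Type*} [Fintype ι] (x y : EuclideanSpace ℂ ι) :
    inner ℝ x y = (inner ℂ x y).re := by
  simp [PiLp.inner_apply, Complex.inner]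

lemma grad_formula_s4 {N r : ℕ}
    (b : Fin N → EuclideanSpace ℂ (Fin r)) (αC : EuclideanSpace ℂ (Fin r))
    (f : EuclideanSpace ℂ (Fin N ⊕ Fin N) → ℝ)
    (hf : ∀ z, f z = ‖∑ j, (z (Sum.inl j) * z (Sum.inr j)) • b j - αC‖ ^ 2)
    (z : EuclideanSpace ℂ (Fin N ⊕ Fin N)) :
    ∃ w : EuclideanSpace ℂ (Fin N ⊕ Fin N), HasGradientAt f w z ∧
      8 * ∑ j, ‖z (Sum.inl j) * z (Sum.inr j)‖ *
        ‖inner ℂ (b j) (∑ j, (z (Sum.inl j) * z (Sum.inr j)) • b j - αC)‖ ^ 2 ≤ ‖w‖ ^ 2 := by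
  set m := ∑ j, (z (Sum.inl j) * z (Sum.inr j)) • b j - αC with hm
  let w : EuclideanSpace ℂ (Fin N ⊕ Fin N) := WithLp.toLp 2 (Sum.elim
    (fun j => 2 * (starRingEnd ℂ (z (Sum.inr j)) * inner ℂ (b j) m))
    (fun j => 2 * (starRingEnd ℂ (z (Sum.inl j)) * inner ℂ (b j) m)))
  refine ⟨w, ?_, ?_⟩
  · rw [hasGradientAt_iff_hasFDerivAt]
    let pr : (Fin N ⊕ Fin N) → EuclideanSpace ℂ (Fin N ⊕ Fin N) →L[ℝ] ℂ :=
      fun i => (EuclideanSpace.proj (𝕜 := ℂ) i).restrictScalars ℝ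
    have hpr : ∀ i, HasFDerivAt (fun z : EuclideanSpace ℂ (Fin N ⊕ Fin N) => z i) (pr i) z :=
      fun i => (pr i).hasFDerivAt
    have h1 : HasFDerivAt (fun z : EuclideanSpace ℂ (Fin N ⊕ Fin N) =>
        ∑ j, (z (Sum.inl j) * z (Sum.inr j)) • b j - αC) _ z :=
      (HasFDerivAt.fun_sum (u := Finset.univ) fun j _ =>
        ((hpr (Sum.inl j)).mul (hpr (Sum.inr j))).smul_const (b j)).sub_const αC
    have h2 := h1.norm_sq
    have hfe : f = fun z => ‖∑ j, (z (Sum.inl j) * z (Sum.inr j)) • b j - αC‖ ^ 2 := funext hf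
    rw [hfe]
    refine h2.congr_fderiv ?_
    ext v
    have e1 : ∀ c : ℂ, ∀ j, inner ℝ m (c • b j) = (c * starRingEnd ℂ (inner ℂ (b j) m)).re := by
      intro c j
      rw [inner_real_eq, inner_smul_right, inner_conj_symm]
    simp only [ContinuousLinearMap.smul_apply, ContinuousLinearMap.comp_apply,
      ContinuousLinearMap.sum_apply, innerSL_apply_apply, InnerProductSpace.toDual_apply_apply,
      ContinuousLinearMap.smulRight_apply, inner_sum, ← hm, e1, ContinuousLinearMap.add_apply]
    rw [inner_real_eq, PiLp.inner_apply, Fintype.sum_sum_type, ← Finset.sum_add_distrib,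
      Complex.re_sum, Finset.smul_sum]
    refine Finset.sum_congr rfl fun j _ => ?_
    simp [w, pr]
    ring
  · rw [EuclideanSpace.norm_sq_eq, Fintype.sum_sum_type, ← Finset.sum_add_distrib, Finset.mul_sum]
    refine Finset.sum_le_sum fun j _ => ?_
    simp only [w, Sum.elim_inl, Sum.elim_inr, norm_mul, RCLike.norm_conj, Complex.norm_ofNat]
    nlinarith [mul_nonneg (sq_nonneg (‖z (Sum.inl j)‖ - ‖z (Sum.inr j)‖))
      (sq_nonneg ‖inner ℂ (b j) m‖)]

/-- **Flow-closedness of `‖μ_c‖²` for a linear torus action (Jeffrey–Kiem–Kirwan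
conjecture, torus case).**  On `T*ℂᴺ = ℂᴺ × ℂᴺ` (modelled as
`EuclideanSpace ℂ (Fin N ⊕ Fin N)`, with `x j = z (Sum.inl j)`, `y j = z (Sum.inr j)`),
let `μ_c (x,y) = ∑ⱼ xⱼ yⱼ βⱼ - α_ℂ` and `f = ‖μ_c‖²`.  Every trajectory of the
negative gradient flow of `f` defined on `[0, ∞)` converges as `t → ∞`; in
particular it is contained in a compact set. -/
theorem stmt_4
    (N r : ℕ) (hN : 1 ≤ N) (hr : 1 ≤ r)
    (β : Fin N → Fin r → ℝ) (αC : EuclideanSpace ℂ (Fin r))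
    (μc : EuclideanSpace ℂ (Fin N ⊕ Fin N) → EuclideanSpace ℂ (Fin r))
    (hμc : ∀ z : EuclideanSpace ℂ (Fin N ⊕ Fin N), ∀ a : Fin r,
      μc z a = (∑ j, z (Sum.inl j) * z (Sum.inr j) * (β j a : ℂ)) - αC a)
    (f : EuclideanSpace ℂ (Fin N ⊕ Fin N) → ℝ)
    (hf : ∀ z, f z = ‖μc z‖ ^ 2)
    (z : ℝ → EuclideanSpace ℂ (Fin N ⊕ Fin N))
    (hz : ∀ t : ℝ, 0 ≤ t → HasDerivWithinAt z (-(gradient f (z t))) (Set.Ici 0) t) :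
    (∃ L : EuclideanSpace ℂ (Fin N ⊕ Fin N), Filter.Tendsto z Filter.atTop (nhds L)) ∧
      ∃ K : Set (EuclideanSpace ℂ (Fin N ⊕ Fin N)), IsCompact K ∧
        ∀ t : ℝ, 0 ≤ t → z t ∈ K := by
  have hzc : ContinuousOn z (Set.Ici 0) := fun t ht => (hz t ht).continuousWithinAt
  let b : Fin N → EuclideanSpace ℂ (Fin r) := fun j => WithLp.toLp 2 fun a => (β j a : ℂ)
  have hμ : ∀ z, μc z = ∑ j, (z (Sum.inl j) * z (Sum.inr j)) • b j - αC := by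
    intro z
    ext a
    rw [hμc]
    simp [b]
  have hf' : ∀ z, f z = ‖∑ j, (z (Sum.inl j) * z (Sum.inr j)) • b j - αC‖ ^ 2 := fun z => by
    rw [hf, hμ]
  choose w hw hwE using grad_formula_s4 b αC f hf'
  obtain ⟨s, C, hC, hkey⟩ := key b αC
  have hex : ∃ L, Filter.Tendsto z Filter.atTop (nhds L) := by
    refine flow_conv z (fun t => -(gradient f (z t))) (fun t => f (z t)) hz ?_ ?_ s C hC ?_
    · intro t ht
      have h1 := (hasGradientAt_iff_hasFDerivAt.1 (hw (z t))).comp_hasDerivWithinAt t (hz t ht)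
      refine h1.congr_deriv ?_
      rw [(hw (z t)).gradient, InnerProductSpace.toDual_apply_apply, inner_neg_right,
        real_inner_self_eq_norm_sq, norm_neg]
    · intro t _
      rw [hf]
      positivity
    · intro t _ e he hve
      rw [(hw (z t)).gradient, norm_neg] at hve
      have h2 := hwE (z t)
      have h3 : 0 ≤ ∑ j, ‖z t (Sum.inl j) * z t (Sum.inr j)‖ *
          ‖inner ℂ (b j) (∑ j, (z t (Sum.inl j) * z t (Sum.inr j)) • b j - αC)‖ ^ 2 :=
        Finset.sum_nonneg fun _ _ => by positivity
      obtain ⟨J, hJ⟩ := hkey (fun j => z t (Sum.inl j) * z t (Sum.inr j)) _ e rfl he (by linarith)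
      refine ⟨J, ?_⟩
      rw [hf']
      exact hJ
  refine ⟨hex, ?_⟩
  obtain ⟨L, hL⟩ := hex
  obtain ⟨T, hT⟩ := Filter.eventually_atTop.1 (hL.eventually (Metric.closedBall_mem_nhds L one_pos))
  refine ⟨z '' Set.Icc 0 T ∪ Metric.closedBall L 1,
    (isCompact_Icc.image_of_continuousOn (hzc.mono fun x hx => hx.1)).union
      (isCompact_closedBall L 1), fun t ht => ?_⟩
  rcases le_total t T with h | h
  · exact Or.inl ⟨t, ⟨ht, h⟩, rfl⟩
  · exact Or.inr (hT t h)
end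

section
/- Let I ⊆ R be a homogeneous ideal with S = R/I finite-dimensional over k, let d be the top degree of S (the largest d with S_d ≠ 0), and let S^∨ be the Fourier dual of S. Then S is level if and only if the R-module S^∨ is generated by its homogeneous elements of degree d, and S satisfies Poincaré duality if and only if S^∨ is generated as an R-module by a single homogeneous polynomial of degree d. -/
open MvPolynomial

/-- The differential operator associated to a monomial `m`: the composition of the
partial derivatives `∂/∂λᵢ` iterated `m i` times. -/
noncomputable def Dmon {k : Type*} [CommSemiring k] {n : ℕ} (m : Fin n →₀ ℕ) :
    Module.End k (MvPolynomial (Fin n) k) :=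
  (List.ofFn fun i : Fin n =>
    ((pderiv i).toLinearMap : Module.End k (MvPolynomial (Fin n) k)) ^ m i).prod

/-- The constant-coefficient differential operator `D_f` obtained from a polynomial `f`
by substituting `∂/∂λᵢ` for `Xᵢ`. -/
noncomputable def Dop {k : Type*} [CommSemiring k] {n : ℕ}
    (f : MvPolynomial (Fin n) k) : Module.End k (MvPolynomial (Fin n) k) :=
  ∑ m ∈ f.support, MvPolynomial.coeff m f • Dmon m

/-- The weight `∏ (a i)!` of a monomial. -/
noncomputable def wt (k : Type*) [Field k] {n : ℕ} (a : Fin n →₀ ℕ) : k :=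
  ∏ i, ((a i).factorial : k)

/-- The pairing `⟨g, f⟩ = (D_f g)(0)`. -/
noncomputable def Lp (k : Type*) [Field k] (n : ℕ) :
    MvPolynomial (Fin n) k →ₗ[k] (MvPolynomial (Fin n) k →ₗ[k] k) :=
  ((basisMonomials (Fin n) k).constr k).toLinearMap ∘ₗ
    LinearMap.pi (fun a => wt k a • lcoeff k a)

section
variable {k : Type*} [Field k] {n : ℕ}

theorem Lp_monomial (g : MvPolynomial (Fin n) k) (a : Fin n →₀ ℕ) (c : k) :
    Lp k n g (monomial a c) = c * (wt k a * coeff a g) := by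
  have h : monomial a c = c • (basisMonomials (Fin n) k a) := by
    simp [coe_basisMonomials, smul_monomial]
  rw [h, map_smul]
  simp only [Lp, LinearMap.comp_apply, LinearEquiv.coe_coe]
  rw [Module.Basis.constr_basis]
  simp

theorem wt_ne_zero [CharZero k] (a : Fin n →₀ ℕ) : wt k a ≠ 0 := by
  rw [wt, Finset.prod_ne_zero_iff]
  intro i _
  exact_mod_cast (a i).factorial_ne_zero

theorem wt_add_single (a : Fin n →₀ ℕ) (i : Fin n) :
    wt k (a + Finsupp.single i 1) = wt k a * (a i + 1) := by
  classical
  rw [wt, wt, ← Finset.mul_prod_erase _ _ (Finset.mem_univ i),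
    ← Finset.mul_prod_erase _ (fun j => ((a j).factorial : k)) (Finset.mem_univ i)]
  have : ∀ j ∈ Finset.univ.erase i, (((a + Finsupp.single i 1 : Fin n →₀ ℕ) j).factorial : k)
      = ((a j).factorial : k) := by
    intro j hj
    have : j ≠ i := Finset.ne_of_mem_erase hj
    simp [Finsupp.single_apply, this.symm]
  rw [Finset.prod_congr rfl this]
  simp [Nat.factorial_succ]
  ring

theorem Lp_inj [CharZero k] {g g' : MvPolynomial (Fin n) k} (h : Lp k n g = Lp k n g') :
    g = g' := by
  ext a
  have := congrArg (fun φ => φ (monomial a 1)) h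
  simpa [Lp_monomial, wt_ne_zero] using this

theorem Lp_pderiv (i : Fin n) (g f : MvPolynomial (Fin n) k) :
    Lp k n (pderiv i g) f = Lp k n g (X i * f) := by
  induction f using MvPolynomial.induction_on' with
  | add p q hp hq => simp only [map_add, mul_add, hp, hq]
  | monomial a c =>
    rw [X, monomial_mul, Lp_monomial, Lp_monomial, coeff_pderiv, add_comm (Finsupp.single i 1) a,
      wt_add_single]
    ring

theorem Lp_pderiv_pow (i : Fin n) (m : ℕ) (g f : MvPolynomial (Fin n) k) :
    Lp k n ((((pderiv i).toLinearMap : Module.End k (MvPolynomial (Fin n) k)) ^ m) g) f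
      = Lp k n g (X i ^ m * f) := by
  induction m generalizing g f with
  | zero => simp
  | succ m ih =>
    rw [pow_succ, Module.End.mul_apply, ih]
    erw [Lp_pderiv]
    rw [pow_succ]
    congr 1
    ring

theorem Lp_list (l : List (Fin n)) (m : Fin n → ℕ) (g f : MvPolynomial (Fin n) k) :
    Lp k n ((l.map fun i : Fin n =>
      ((pderiv i).toLinearMap : Module.End k (MvPolynomial (Fin n) k)) ^ m i).prod g) f
      = Lp k n g ((l.map fun i => (X i : MvPolynomial (Fin n) k) ^ m i).prod * f) := by
  induction l generalizing g f with
  | nil => simp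
  | cons i l ih =>
    rw [List.map_cons, List.prod_cons, Module.End.mul_apply, Lp_pderiv_pow, ih, List.map_cons,
      List.prod_cons]
    congr 1
    ring

theorem Lp_Dmon (m : Fin n →₀ ℕ) (g f : MvPolynomial (Fin n) k) :
    Lp k n (Dmon m g) f = Lp k n g (monomial m 1 * f) := by
  rw [Dmon, List.ofFn_eq_map, Lp_list, ← List.ofFn_eq_map, List.prod_ofFn, monomial_eq,
    Finsupp.prod_fintype _ _ (by simp)]
  simp

theorem Lp_Dop (F g f : MvPolynomial (Fin n) k) :
    Lp k n (Dop F g) f = Lp k n g (F * f) := by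
  conv_rhs => rw [F.as_sum, Finset.sum_mul, map_sum]
  rw [Dop, LinearMap.sum_apply, map_sum, LinearMap.sum_apply]
  refine Finset.sum_congr rfl fun m _ => ?_
  rw [LinearMap.smul_apply, map_smul, LinearMap.smul_apply, Lp_Dmon, ← map_smul, ← smul_mul_assoc,
    smul_monomial, smul_eq_mul, mul_one]

theorem dual_iff [CharZero k] (I : Ideal (MvPolynomial (Fin n) k)) (g : MvPolynomial (Fin n) k) :
    (∀ f ∈ I, Dop f g = 0) ↔ ∀ f ∈ I, Lp k n g f = 0 := by
  constructor
  · intro h f hf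
    have := Lp_Dop f g 1
    rw [h f hf] at this
    simpa using this.symm
  · intro h f hf
    apply Lp_inj
    refine LinearMap.ext fun a => ?_
    rw [Lp_Dop, h _ (I.mul_mem_right _ hf)]
    simp

theorem Lp_homog {g : MvPolynomial (Fin n) k} {d e : ℕ} (hg : g.IsHomogeneous d)
    {f : MvPolynomial (Fin n) k} (hf : f.IsHomogeneous e) (h : e ≠ d) : Lp k n g f = 0 := by
  rw [f.as_sum, map_sum]
  refine Finset.sum_eq_zero fun a ha => ?_
  rw [Lp_monomial, hg.coeff_eq_zero (d := a)]
  · simp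
  · rw [hf.degree_eq_sum_deg_support ha] at h
    exact h

theorem Lp_ext {φ ψ : MvPolynomial (Fin n) k →ₗ[k] k}
    (h : ∀ e f, f.IsHomogeneous e → φ f = ψ f) : φ = ψ := by
  ext1 a
  ext
  exact h _ _ (isHomogeneous_monomial _ rfl)

theorem Lp_surj [CharZero k] (d : ℕ) (φ : MvPolynomial (Fin n) k →ₗ[k] k)
    (h : ∀ e, d < e → ∀ f : MvPolynomial (Fin n) k, f.IsHomogeneous e → φ f = 0) :
    ∃ g, Lp k n g = φ := by
  classical
  have hs : (Set.Finite {a : Fin n →₀ ℕ | a.degree ≤ d}) := by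
    exact Finsupp.finite_of_degree_le d
  refine ⟨∑ a ∈ hs.toFinset, monomial a ((wt k a)⁻¹ * φ (monomial a 1)), ?_⟩
  ext1 a
  ext
  change Lp k n _ (monomial a 1) = φ (monomial a 1)
  rw [Lp_monomial, coeff_sum]
  simp only [coeff_monomial, Finset.sum_ite_eq', Set.Finite.mem_toFinset, Set.mem_setOf_eq]
  split_ifs with ha
  · field_simp [wt_ne_zero (k := k) a]
  · rw [h _ (not_le.mp ha) _ (isHomogeneous_monomial _ rfl)]
    simp

theorem homog_of_Lp [CharZero k] {g : MvPolynomial (Fin n) k} {d : ℕ}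
    (h : ∀ e, e ≠ d → ∀ f : MvPolynomial (Fin n) k, f.IsHomogeneous e → Lp k n g f = 0) :
    g.IsHomogeneous d := by
  have : g = homogeneousComponent d g := by
    ext a
    rw [coeff_homogeneousComponent]
    split_ifs with ha
    · rfl
    · have := h _ ha (monomial a 1) (isHomogeneous_monomial _ rfl)
      simpa [Lp_monomial, wt_ne_zero] using this
  rw [this]
  exact homogeneousComponent_isHomogeneous _ _

/-- Separation by elements of the dual. -/
theorem exists_sep [CharZero k] (I : Ideal (MvPolynomial (Fin n) k)) (d : ℕ)
    (hd_top : ∀ e : ℕ, d < e → ∀ f : MvPolynomial (Fin n) k, f.IsHomogeneous e → f ∈ I)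
    {f : MvPolynomial (Fin n) k} (hf : f ∉ I) :
    ∃ g, (∀ f ∈ I, Lp k n g f = 0) ∧ Lp k n g f ≠ 0 := by
  obtain ⟨φ, h1, h2⟩ := Submodule.exists_le_ker_of_notMem (p := I.restrictScalars k) (v := f)
    (by simpa using hf)
  have h2' : ∀ f ∈ I, φ f = 0 := fun f hf => h2 hf
  obtain ⟨g, rfl⟩ := Lp_surj d φ (fun e he f hf => h2' f (hd_top e he f hf))
  exact ⟨g, h2', h1⟩

theorem exists_sep_homog [CharZero k] (I : Ideal (MvPolynomial (Fin n) k)) (d : ℕ)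
    (hI : ∀ f ∈ I, ∀ e : ℕ, MvPolynomial.homogeneousComponent e f ∈ I)
    (hd_top : ∀ e : ℕ, d < e → ∀ f : MvPolynomial (Fin n) k, f.IsHomogeneous e → f ∈ I)
    {f : MvPolynomial (Fin n) k} (hfd : f.IsHomogeneous d) (hf : f ∉ I) :
    ∃ g, g.IsHomogeneous d ∧ (∀ f ∈ I, Lp k n g f = 0) ∧ Lp k n g f ≠ 0 := by
  obtain ⟨g, h1, h2⟩ := exists_sep I d hd_top hf
  have h3 : ∀ e, e ≠ d → ∀ f : MvPolynomial (Fin n) k, f.IsHomogeneous e →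
      (Lp k n g ∘ₗ homogeneousComponent d) f = 0 := by
    intro e he f hf
    rw [LinearMap.comp_apply, homogeneousComponent_of_mem hf, if_neg (Ne.symm he), map_zero]
  obtain ⟨g', hg'⟩ := Lp_surj d (Lp k n g ∘ₗ homogeneousComponent d)
    (fun e he => h3 e he.ne')
  refine ⟨g', homog_of_Lp (by rw [hg']; exact h3), ?_, ?_⟩
  · intro f hf
    rw [hg']
    exact h1 _ (hI f hf d)
  · rw [hg', LinearMap.comp_apply, homogeneousComponent_eq_self hfd]
    exact h2

/-- A homogeneous functional of degree `d` nonzero on `F * f`, `f` homogeneous of degree `e`. -/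
theorem exists_comp {H : MvPolynomial (Fin n) k} {d e : ℕ} (hH : H.IsHomogeneous d)
    {f F : MvPolynomial (Fin n) k} (hf : f.IsHomogeneous e) (h : Lp k n H (F * f) ≠ 0) :
    ∃ j, e + j = d ∧ Lp k n H (homogeneousComponent j F * f) ≠ 0 := by
  rw [← sum_homogeneousComponent F, Finset.sum_mul, map_sum] at h
  obtain ⟨j, -, hj⟩ := Finset.exists_ne_zero_of_sum_ne_zero h
  refine ⟨j, ?_, hj⟩
  by_contra hne
  apply hj
  refine Lp_homog hH ((homogeneousComponent_isHomogeneous j F).mul hf) ?_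
  omega

theorem level_of_gen [CharZero k] (I : Ideal (MvPolynomial (Fin n) k)) (d : ℕ)
    (hd_top : ∀ e : ℕ, d < e → ∀ f : MvPolynomial (Fin n) k, f.IsHomogeneous e → f ∈ I)
    (hgen : ∀ g : MvPolynomial (Fin n) k, (∀ f ∈ I, Dop f g = 0) →
        ∃ (m : ℕ) (F : Fin m → MvPolynomial (Fin n) k)
          (Hh : Fin m → MvPolynomial (Fin n) k),
          (∀ i, (∀ f ∈ I, Dop f (Hh i) = 0) ∧ (Hh i).IsHomogeneous d) ∧
          g = ∑ i, Dop (F i) (Hh i)) (f : MvPolynomial (Fin n) k) (hf : f ∉ I) :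
    ∃ q h : MvPolynomial (Fin n) k, h.IsHomogeneous d ∧ h ∉ I ∧ f * q - h ∈ I := by
  classical
  have hex : ∃ e, homogeneousComponent e f ∉ I := by
    by_contra! hcon
    apply hf
    rw [← sum_homogeneousComponent f]
    exact I.sum_mem fun i _ => hcon i
  set e := Nat.find hex with he
  have he1 : homogeneousComponent e f ∉ I := Nat.find_spec hex
  have he2 : ∀ j < e, homogeneousComponent j f ∈ I := fun j hj => by
    simpa using Nat.find_min hex hj
  obtain ⟨g, hg1, hg2⟩ := exists_sep I d hd_top he1
  obtain ⟨m, F, H, hH, rfl⟩ := hgen g ((dual_iff I g).2 hg1)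
  rw [map_sum, LinearMap.sum_apply] at hg2
  obtain ⟨i, -, hi⟩ := Finset.exists_ne_zero_of_sum_ne_zero hg2
  rw [Lp_Dop] at hi
  obtain ⟨j, hj, hji⟩ := exists_comp (hH i).2 (homogeneousComponent_isHomogeneous e f) hi
  refine ⟨homogeneousComponent j (F i), homogeneousComponent e f * homogeneousComponent j (F i),
    ?_, ?_, ?_⟩
  · rw [← hj]
    exact (homogeneousComponent_isHomogeneous _ _).mul (homogeneousComponent_isHomogeneous _ _)
  · intro hmem
    rw [mul_comm] at hmem
    exact hji ((dual_iff I _).1 (hH i).1 _ hmem)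
  · have hef : e ∈ Finset.range (f.totalDegree + 1) := by
      rw [Finset.mem_range]
      by_contra hlt
      apply he1
      rw [homogeneousComponent_eq_zero _ _ (by omega)]
      exact I.zero_mem
    rw [← sub_mul]
    have : f - homogeneousComponent e f =
        ∑ i ∈ (Finset.range (f.totalDegree + 1)).erase e, homogeneousComponent i f := by
      rw [sub_eq_iff_eq_add, Finset.sum_erase_add _ _ hef, sum_homogeneousComponent]
    rw [this, Finset.sum_mul]
    refine I.sum_mem fun l hl => ?_
    rcases lt_or_gt_of_ne (Finset.ne_of_mem_erase hl) with hlt | hgt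
    · exact I.mul_mem_right _ (he2 l hlt)
    · exact hd_top (l + j) (by omega) _ ((homogeneousComponent_isHomogeneous _ _).mul
        (homogeneousComponent_isHomogeneous _ _))

theorem Dop_smul [CharZero k] (c : k) (F g : MvPolynomial (Fin n) k) :
    Dop (c • F) g = c • Dop F g := by
  apply Lp_inj
  refine LinearMap.ext fun a => ?_
  simp only [map_smul, LinearMap.smul_apply, Lp_Dop, smul_mul_assoc]

theorem Dop_sum [CharZero k] {m : ℕ} (F : Fin m → MvPolynomial (Fin n) k)
    (g : MvPolynomial (Fin n) k) :
    Dop (∑ i, F i) g = ∑ i, Dop (F i) g := by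
  apply Lp_inj
  refine LinearMap.ext fun a => ?_
  simp only [map_sum, LinearMap.sum_apply, Lp_Dop, Finset.sum_mul]

theorem gen_of_level [CharZero k] (I : Ideal (MvPolynomial (Fin n) k)) (d : ℕ)
    (hI : ∀ f ∈ I, ∀ e : ℕ, MvPolynomial.homogeneousComponent e f ∈ I)
    (hfin : FiniteDimensional k (MvPolynomial (Fin n) k ⧸ I))
    (hd_top : ∀ e : ℕ, d < e → ∀ f : MvPolynomial (Fin n) k, f.IsHomogeneous e → f ∈ I)
    (hlev : ∀ f : MvPolynomial (Fin n) k, f ∉ I →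
        ∃ q h : MvPolynomial (Fin n) k, h.IsHomogeneous d ∧ h ∉ I ∧ f * q - h ∈ I)
    (g : MvPolynomial (Fin n) k) (hg : ∀ f ∈ I, Dop f g = 0) :
        ∃ (m : ℕ) (F : Fin m → MvPolynomial (Fin n) k)
          (Hh : Fin m → MvPolynomial (Fin n) k),
          (∀ i, (∀ f ∈ I, Dop f (Hh i) = 0) ∧ (Hh i).IsHomogeneous d) ∧
          g = ∑ i, Dop (F i) (Hh i) := by
  set G : Set (MvPolynomial (Fin n) k) :=
    {u | ∃ F H, ((∀ f ∈ I, Dop f H = 0) ∧ H.IsHomogeneous d) ∧ Dop F H = u} with hG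
  set W : Submodule k (Module.Dual k (MvPolynomial (Fin n) k)) :=
    (Submodule.span k G).map (Lp k n) with hW
  have hWle : W ≤ (I.restrictScalars k).dualAnnihilator := by
    rw [hW, Submodule.map_span_le]
    rintro _ ⟨F, H, ⟨hH, -⟩, rfl⟩
    rw [Submodule.mem_dualAnnihilator]
    intro f hf
    rw [Lp_Dop]
    exact (dual_iff I H).1 hH _ (I.mul_mem_left _ hf)
  have : FiniteDimensional k (MvPolynomial (Fin n) k ⧸ I.restrictScalars k) :=
    Module.Finite.equiv (Submodule.Quotient.restrictScalarsEquiv k I).symm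
  have : FiniteDimensional k (I.restrictScalars k).dualAnnihilator :=
    Module.Finite.equiv (I.restrictScalars k).dualQuotEquivDualAnnihilator
  have : FiniteDimensional k W := Submodule.finiteDimensional_of_le hWle
  have hgW : Lp k n g ∈ W := by
    rw [← Subspace.dualCoannihilator_dualAnnihilator_eq (W := W), Submodule.mem_dualAnnihilator]
    intro f hf
    rw [Submodule.mem_dualCoannihilator] at hf
    refine (dual_iff I g).1 hg f ?_
    by_contra hfI
    obtain ⟨q, h, hh, hhI, hfq⟩ := hlev f hfI
    obtain ⟨H, hH1, hH2, hH3⟩ := exists_sep_homog I d hI hd_top hh hhI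
    have h1 := hf (Lp k n (Dop q H)) (Submodule.mem_map_of_mem (Submodule.subset_span
      ⟨q, H, ⟨(dual_iff I H).2 hH2, hH1⟩, rfl⟩))
    have h2 := hH2 _ hfq
    rw [map_sub, sub_eq_zero] at h2
    rw [Lp_Dop, mul_comm, h2] at h1
    exact hH3 h1
  obtain ⟨g', hg', hgg⟩ := hgW
  obtain rfl := Lp_inj hgg
  obtain ⟨m, c, u, hu⟩ := Submodule.mem_span_set'.1 hg'
  choose F H hH hFH using fun i => (u i).2
  refine ⟨m, fun i => c i • F i, H, hH, ?_⟩
  rw [← hu]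
  exact Finset.sum_congr rfl fun i _ => by rw [Dop_smul, hFH]

end

/-- **Levelness and Poincaré duality via the Fourier dual.**  Let `I ⊆ R = k[X₁,…,Xₙ]`
be a homogeneous ideal with `S = R/I` finite-dimensional, and let `d` be the top degree
of `S`.  Then:
* `S` is level (every element not in `I` divides, modulo `I`, a homogeneous degree-`d`
  element not in `I`) iff the Fourier dual `S^∨` is generated as an `R`-module by its
  homogeneous elements of degree `d`;
* `S` satisfies Poincaré duality (level and `S_d` one-dimensional) iff `S^∨` is
  generated as an `R`-module by a single homogeneous polynomial of degree `d`. -/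
theorem stmt_11
    {k : Type*} [Field k] [CharZero k] {n : ℕ}
    (I : Ideal (MvPolynomial (Fin n) k))
    (hI : ∀ f ∈ I, ∀ e : ℕ, MvPolynomial.homogeneousComponent e f ∈ I)
    (hfin : FiniteDimensional k (MvPolynomial (Fin n) k ⧸ I))
    (d : ℕ)
    (hd_ne : ∃ f : MvPolynomial (Fin n) k, f.IsHomogeneous d ∧ f ∉ I)
    (hd_top : ∀ e : ℕ, d < e → ∀ f : MvPolynomial (Fin n) k, f.IsHomogeneous e → f ∈ I) :
    ((∀ f : MvPolynomial (Fin n) k, f ∉ I →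
        ∃ q h : MvPolynomial (Fin n) k, h.IsHomogeneous d ∧ h ∉ I ∧ f * q - h ∈ I) ↔
      (∀ g : MvPolynomial (Fin n) k, (∀ f ∈ I, Dop f g = 0) →
        ∃ (m : ℕ) (F : Fin m → MvPolynomial (Fin n) k)
          (Hh : Fin m → MvPolynomial (Fin n) k),
          (∀ i, (∀ f ∈ I, Dop f (Hh i) = 0) ∧ (Hh i).IsHomogeneous d) ∧
          g = ∑ i, Dop (F i) (Hh i))) ∧
    (((∀ f : MvPolynomial (Fin n) k, f ∉ I →
        ∃ q h : MvPolynomial (Fin n) k, h.IsHomogeneous d ∧ h ∉ I ∧ f * q - h ∈ I) ∧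
      ∃ h₀ : MvPolynomial (Fin n) k, h₀.IsHomogeneous d ∧ h₀ ∉ I ∧
        ∀ h : MvPolynomial (Fin n) k, h.IsHomogeneous d →
          ∃ c : k, h - MvPolynomial.C c * h₀ ∈ I) ↔
      ∃ h₀ : MvPolynomial (Fin n) k, h₀.IsHomogeneous d ∧
        ∀ g : MvPolynomial (Fin n) k,
          ((∀ f ∈ I, Dop f g = 0) ↔ ∃ F : MvPolynomial (Fin n) k, g = Dop F h₀)) := by
  refine ⟨⟨fun h => gen_of_level I d hI hfin hd_top h, fun h => level_of_gen I d hd_top h⟩,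
    ?_, ?_⟩
  · rintro ⟨hlev, h₀, hh₀, hh₀I, hspan⟩
    obtain ⟨g₀, hg₀, hg₀I, hg₀h⟩ := exists_sep_homog I d hI hd_top hh₀ hh₀I
    refine ⟨g₀, hg₀, fun g => ⟨fun hg => ?_, ?_⟩⟩
    · obtain ⟨m, F, H, hH, rfl⟩ := gen_of_level I d hI hfin hd_top hlev g hg
      have key : ∀ i, H i = (Lp k n (H i) h₀ / Lp k n g₀ h₀) • g₀ := by
        intro i
        apply Lp_inj
        apply Lp_ext
        intro e f hf
        rw [map_smul, LinearMap.smul_apply]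
        by_cases hed : e = d
        · subst hed
          obtain ⟨c, hc⟩ := hspan f hf
          have h1 := (dual_iff I _).1 (hH i).1 _ hc
          have h2 := hg₀I _ hc
          rw [map_sub, sub_eq_zero, ← smul_eq_C_mul, map_smul] at h1 h2
          rw [h1, h2, smul_eq_mul, smul_eq_mul, smul_eq_mul]
          field_simp
        · rw [Lp_homog (hH i).2 hf hed, Lp_homog hg₀ hf hed, smul_zero]
      refine ⟨∑ i, (Lp k n (H i) h₀ / Lp k n g₀ h₀) • F i, ?_⟩
      rw [Dop_sum]
      refine Finset.sum_congr rfl fun i _ => ?_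
      rw [Dop_smul, ← map_smul, ← key i]
    · rintro ⟨F, rfl⟩
      rw [dual_iff]
      intro f hf
      rw [Lp_Dop]
      exact hg₀I _ (I.mul_mem_left _ hf)
  · rintro ⟨g₀, hg₀, hgen⟩
    have hg₀D : ∀ f ∈ I, Dop f g₀ = 0 := by
      refine (hgen g₀).2 ⟨1, ?_⟩
      apply Lp_inj
      refine LinearMap.ext fun a => ?_
      simp only [Lp_Dop, one_mul]
    have hg₀I := (dual_iff I g₀).1 hg₀D
    have key : ∀ u : MvPolynomial (Fin n) k, u.IsHomogeneous d → Lp k n g₀ u = 0 → u ∈ I := by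
      intro u hu h0
      by_contra huI
      obtain ⟨g, hg1, hg2⟩ := exists_sep I d hd_top huI
      obtain ⟨F, rfl⟩ := (hgen g).1 ((dual_iff I g).2 hg1)
      rw [Lp_Dop] at hg2
      obtain ⟨j, hj, hj2⟩ := exists_comp hg₀ hu hg2
      obtain rfl : j = 0 := by omega
      apply hj2
      rw [homogeneousComponent_zero, ← smul_eq_C_mul, map_smul, h0, smul_zero]
    obtain ⟨f, hf, hfI⟩ := hd_ne
    refine ⟨level_of_gen I d hd_top fun g hg => ?_, f, hf, hfI, fun h hh => ?_⟩
    · obtain ⟨F, hF⟩ := (hgen g).1 hg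
      exact ⟨1, fun _ => F, fun _ => g₀, fun _ => ⟨hg₀D, hg₀⟩, by simpa using hF⟩
    · have hne : Lp k n g₀ f ≠ 0 := fun h0 => hfI (key f hf h0)
      refine ⟨Lp k n g₀ h / Lp k n g₀ f, key _ (hh.sub (hf.C_mul _)) ?_⟩
      rw [map_sub, ← smul_eq_C_mul, map_smul, smul_eq_mul, div_mul_cancel₀ _ hne, sub_self]
end
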